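/- arXiv:1807.08317 — 2 statements merged into one kernel-verified Lean document; each statement's English description precedes it below -/
import Mathlib

section
/- Let d ≥ 1, and let ℏ, m, V₀ > 0. Let g ∈ C²(ℝ^d; ℝ) be even with ∇g(0) = 0 and with g and all of its partial derivatives up to order 2 bounded and continuous. Suppose R : ℝ^d × ℝ^d × [0,∞) → ℂ is C¹ in t, for each t the function R(·,·,t) is Schwartz class (with Schwartz seminorms locally bounded in t), and R solves the averaged quantum stochastic Liouville equation ∂_t R(x,x',t) = −(iℏ/(2m))(Δ_x − Δ_{x'})R(x,x',t) − (V₀/ℏ)²(g(0) − g(x−x'))R(x,x',t). Then the mean square displacement satisfies ∫_{ℝ^d} ‖x‖² R(x,x,t) dx = −(1/3)(V₀/m)² (Δg)(0) (∫_{ℝ^d} R(x,x,0) dx) t³ + O(t²) as t → ∞; in particular, if (Δg)(0) < 0 and ∫ R(x,x,0) dx > 0, the motion is superballistic of order t³. -/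
open MeasureTheory Filter Asymptotics

/-- The Laplacian `Σ_i ∂²f/∂x_i²(x)` of a complex-valued function on `ℝ^d`. -/
noncomputable def euclLaplacianC (d : ℕ) (f : EuclideanSpace ℝ (Fin d) → ℂ)
    (x : EuclideanSpace ℝ (Fin d)) : ℂ :=
  ∑ i : Fin d,
    fderiv ℝ (fun y => fderiv ℝ f y (EuclideanSpace.single i 1)) x
      (EuclideanSpace.single i 1)

/-- The Laplacian `Σ_i ∂²g/∂x_i²(x)` of a real-valued function on `ℝ^d`. -/
noncomputable def euclLaplacianR (d : ℕ) (g : EuclideanSpace ℝ (Fin d) → ℝ)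
    (x : EuclideanSpace ℝ (Fin d)) : ℝ :=
  ∑ i : Fin d,
    fderiv ℝ (fun y => fderiv ℝ g y (EuclideanSpace.single i 1)) x
      (EuclideanSpace.single i 1)

open scoped SchwartzMap LineDeriv Topology

section General

variable {α : Type*} [MeasurableSpace α] {μ : Measure α}

theorem hasDerivWithinAt_integral_of_locally_dominated {u u' : ℝ → α → ℂ}
    (hu : ∀ t, Integrable (u t) μ)
    (hbound : ∀ T : ℝ, ∃ B : α → ℝ, Integrable B μ ∧ ∀ t ∈ Set.Icc 0 T, ∀ x, ‖u' t x‖ ≤ B x)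
    (hderiv : ∀ x, ∀ t, 0 ≤ t → HasDerivWithinAt (fun τ => u τ x) (u' t x) (Set.Ici 0) t)
    {t : ℝ} (ht : 0 ≤ t) :
    HasDerivWithinAt (fun τ => ∫ x, u τ x ∂μ) (∫ x, u' t x ∂μ) (Set.Ici 0) t := by
  obtain ⟨B, hB, hB'⟩ := hbound (t + 1)
  rw [hasDerivWithinAt_iff_tendsto_slope]
  have hslope : slope (fun τ => ∫ x, u τ x ∂μ) t
      = fun r => ∫ x, slope (fun τ => u τ x) t r ∂μ := by
    funext r
    simp only [slope_def_module]
    rw [integral_smul, integral_sub (hu r) (hu t)]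
  rw [hslope]
  refine tendsto_integral_filter_of_dominated_convergence B ?_ ?_ hB ?_
  · refine Eventually.of_forall fun r => ?_
    simp only [slope_def_module]
    exact (((hu r).sub (hu t)).smul (r - t)⁻¹).aestronglyMeasurable
  · have h1 : ∀ᶠ r in 𝓝[Set.Ici 0 \ {t}] t, r < t + 1 :=
      mem_nhdsWithin_of_mem_nhds (Iio_mem_nhds (by linarith))
    filter_upwards [self_mem_nhdsWithin, h1] with r hr hr1
    refine Eventually.of_forall fun x => ?_
    have hmv := (convex_Icc (0 : ℝ) (t + 1)).norm_image_sub_le_of_norm_hasDerivWithin_le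
      (f := fun τ => u τ x) (f' := fun τ => u' τ x) (C := B x) (x := t) (y := r)
      (fun s hs => (hderiv x s hs.1).mono fun y hy => hy.1) (fun s hs => hB' s hs x)
      ⟨ht, by linarith⟩ ⟨hr.1, hr1.le⟩
    have hne : 0 < ‖r - t‖ := norm_pos_iff.2 (sub_ne_zero.2 hr.2)
    rw [slope_def_module, norm_smul, norm_inv]
    rw [inv_mul_le_iff₀ hne, mul_comm]
    exact hmv
  · exact Eventually.of_forall fun x =>
      hasDerivWithinAt_iff_tendsto_slope.1 (hderiv x t ht)

theorem eq_of_linear_ode {a : ℂ} {b u v : ℝ → ℂ}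
    (hu : ∀ t, 0 ≤ t → HasDerivWithinAt u (b t - a * u t) (Set.Ici 0) t)
    (hv : ∀ t, 0 ≤ t → HasDerivWithinAt v (b t - a * v t) (Set.Ici 0) t)
    (h0 : u 0 = v 0) {t : ℝ} (ht : 0 ≤ t) : u t = v t := by
  have hw : ∀ s, 0 ≤ s → HasDerivWithinAt
      (fun τ : ℝ => Complex.exp (a * τ) * (u τ - v τ)) 0 (Set.Ici 0) s := by
    intro s hs
    have he : HasDerivAt (fun τ : ℝ => Complex.exp (a * τ)) (Complex.exp (a * s) * (a * 1)) s :=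
      (((hasDerivAt_id s).ofReal_comp).const_mul a).cexp
    refine (he.hasDerivWithinAt.mul ((hu s hs).sub (hv s hs))).congr_deriv ?_
    rw [Pi.sub_apply]
    ring
  have hc := constant_of_has_deriv_right_zero (a := 0) (b := t)
    (f := fun τ : ℝ => Complex.exp (a * τ) * (u τ - v τ))
    (fun s hs => (hw s hs.1).continuousWithinAt.mono fun y hy => hy.1)
    (fun s hs => (hw s hs.1).mono fun y hy => le_trans hs.1 hy) t ⟨ht, le_rfl⟩
  simp only [h0, sub_self, mul_zero] at hc
  exact sub_eq_zero.1 ((mul_eq_zero.1 hc).resolve_left (Complex.exp_ne_zero _))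

end General

section Moments

/-- Continuous weights of at most quadratic growth. -/
structure QuadraticGrowth {E : Type*} [NormedAddCommGroup E] (p : E → ℂ) : Prop where
  continuous : Continuous p
  norm_le : ∀ x, ‖p x‖ ≤ (1 + ‖x‖) ^ 2

theorem quadraticGrowth_of_norm_le_one {E : Type*} [NormedAddCommGroup E]
    {c : ℂ} (hc : ‖c‖ ≤ 1) :
    QuadraticGrowth fun _ : E => c :=
  ⟨continuous_const, fun x => hc.trans (one_le_pow₀ (by linarith [norm_nonneg x]))⟩

variable {E : Type*} [NormedAddCommGroup E] [NormedSpace ℝ E]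

/-- A family of Schwartz functions whose seminorms are bounded locally uniformly in time. -/
def LocallyBoundedFamily {F : Type*} [NormedAddCommGroup F] [NormedSpace ℝ F]
    (S : ℝ → 𝓢(F, ℂ)) : Prop :=
  ∀ (k n : ℕ) (T : ℝ), ∃ C : ℝ, ∀ t ∈ Set.Icc (0 : ℝ) T, SchwartzMap.seminorm ℝ k n (S t) ≤ C

theorem LocallyBoundedFamily.finset_sup_le {F : Type*} [NormedAddCommGroup F] [NormedSpace ℝ F]
    {S : ℝ → 𝓢(F, ℂ)} (hS : LocallyBoundedFamily S) (s : Finset (ℕ × ℕ)) (T : ℝ) :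
    ∃ C : ℝ, 0 ≤ C ∧ ∀ t ∈ Set.Icc (0 : ℝ) T,
      s.sup (fun m => SchwartzMap.seminorm ℝ m.1 m.2) (S t) ≤ C := by
  choose C hC using fun m : ℕ × ℕ => hS m.1 m.2 T
  have hnn : 0 ≤ ∑ m ∈ s, |C m| := Finset.sum_nonneg fun m _ => abs_nonneg _
  refine ⟨∑ m ∈ s, |C m|, hnn, fun t ht => Seminorm.finset_sup_apply_le hnn fun m hm => ?_⟩
  exact (hC m t ht).trans ((le_abs_self _).trans
    (Finset.single_le_sum (f := fun m => |C m|) (fun m _ => abs_nonneg _) hm))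

theorem LocallyBoundedFamily.clm_comp {F : Type*} [NormedAddCommGroup F] [NormedSpace ℝ F]
    {S : ℝ → 𝓢(F, ℂ)} (hS : LocallyBoundedFamily S) (L : 𝓢(F, ℂ) →L[ℝ] 𝓢(F, ℂ)) :
    LocallyBoundedFamily fun t => L (S t) := by
  intro k n T
  have hq : Continuous ((SchwartzMap.seminorm ℝ k n).comp L.toLinearMap) :=
    ((schwartz_withSeminorms ℝ F ℂ).continuous_seminorm (k, n)).comp L.continuous
  obtain ⟨s, C, -, hC⟩ := Seminorm.bound_of_continuous (schwartz_withSeminorms ℝ F ℂ) _ hq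
  obtain ⟨D, hD, hD'⟩ := hS.finset_sup_le s T
  refine ⟨C * D, fun t ht => (hC (S t)).trans ?_⟩
  exact mul_le_mul_of_nonneg_left (hD' t ht) C.2

theorem LocallyBoundedFamily.decay {F : Type*} [NormedAddCommGroup F] [NormedSpace ℝ F]
    {S : ℝ → 𝓢(F, ℂ)} (hS : LocallyBoundedFamily S) (N : ℕ) (T : ℝ) :
    ∃ C : ℝ, 0 ≤ C ∧ ∀ t ∈ Set.Icc (0 : ℝ) T, ∀ z, (1 + ‖z‖) ^ N * ‖S t z‖ ≤ C := by
  obtain ⟨D, hD, hD'⟩ := hS.finset_sup_le (Finset.Iic (N, 0)) T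
  refine ⟨2 ^ N * D, by positivity, fun t ht z => ?_⟩
  have h := SchwartzMap.one_add_le_sup_seminorm_apply (𝕜 := ℝ) (m := (N, 0)) (k := N) (n := 0)
    le_rfl le_rfl (S t) z
  rw [norm_iteratedFDeriv_zero] at h
  exact h.trans (mul_le_mul_of_nonneg_left (hD' t ht) (by positivity))

theorem LocallyBoundedFamily.const {F : Type*} [NormedAddCommGroup F] [NormedSpace ℝ F]
    (f : 𝓢(F, ℂ)) : LocallyBoundedFamily fun _ => f :=
  fun k n _ => ⟨SchwartzMap.seminorm ℝ k n f, fun _ _ => le_rfl⟩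

theorem norm_le_norm_add_sub_prod (x y : E) : ‖x‖ ≤ ‖(x + y, x - y)‖ := by
  have h : x = (1 / 2 : ℝ) • ((x + y) + (x - y)) := by
    rw [show (x + y) + (x - y) = (2 : ℝ) • x by rw [two_smul]; abel, smul_smul]
    norm_num
  have h1 := norm_fst_le (x + y, x - y)
  have h2 := norm_snd_le (x + y, x - y)
  simp only at h1 h2
  calc ‖x‖ = (1 / 2) * ‖(x + y) + (x - y)‖ := by
        conv_lhs => rw [h]
        rw [norm_smul]; norm_num
    _ ≤ ‖(x + y, x - y)‖ := by linarith [norm_add_le (x + y) (x - y)]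

theorem LocallyBoundedFamily.weighted_bound [FiniteDimensional ℝ E] [MeasurableSpace E]
    [BorelSpace E] (μ : Measure E) [μ.IsAddHaarMeasure]
    {S : ℝ → 𝓢(E × E, ℂ)} (hS : LocallyBoundedFamily S) (T : ℝ) :
    ∃ B : E → ℝ, Integrable B μ ∧ ∀ p : E → ℂ, QuadraticGrowth p → ∀ t ∈ Set.Icc (0 : ℝ) T,
      ∀ x y, ‖p x * S t (x + y, x - y)‖ ≤ B x := by
  set n := Module.finrank ℝ E + 1 with hn
  obtain ⟨C, hC, hC'⟩ := hS.decay (n + 2) T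
  refine ⟨fun x => C * (1 + ‖x‖) ^ (-(n : ℝ)), (integrable_one_add_norm (by
    rw [hn]; push_cast; linarith)).const_mul C, fun p hp t ht x y => ?_⟩
  have hx : 0 < 1 + ‖x‖ := by positivity
  have h1 : (1 + ‖x‖) ^ (n + 2) * ‖S t (x + y, x - y)‖ ≤ C := by
    refine le_trans ?_ (hC' t ht (x + y, x - y))
    gcongr
    exact norm_le_norm_add_sub_prod x y
  beta_reduce
  rw [Real.rpow_neg hx.le, Real.rpow_natCast, norm_mul,
    ← div_eq_mul_inv, le_div_iff₀ (by positivity)]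
  calc ‖p x‖ * ‖S t (x + y, x - y)‖ * (1 + ‖x‖) ^ n
      ≤ (1 + ‖x‖) ^ 2 * ‖S t (x + y, x - y)‖ * (1 + ‖x‖) ^ n := by
        gcongr; exact hp.norm_le x
    _ = (1 + ‖x‖) ^ (n + 2) * ‖S t (x + y, x - y)‖ := by ring
    _ ≤ C := h1

variable [FiniteDimensional ℝ E] [MeasurableSpace E] [BorelSpace E]
  (μ : Measure E) [μ.IsAddHaarMeasure]

/-- The weighted integral of a kernel along the antidiagonal shift of the diagonal by `y`. -/
noncomputable def shiftedMoment (p : E → ℂ) (f : 𝓢(E × E, ℂ)) (y : E) : ℂ :=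
  ∫ x, p x * f (x + y, x - y) ∂μ

variable {μ}

theorem QuadraticGrowth.integrable {p : E → ℂ} (hp : QuadraticGrowth p) (f : 𝓢(E × E, ℂ)) (y : E) :
    Integrable (fun x => p x * f (x + y, x - y)) μ := by
  obtain ⟨B, hB, hB'⟩ := (LocallyBoundedFamily.const f).weighted_bound μ 0
  refine hB.mono' ?_ (Eventually.of_forall fun x => hB' p hp 0 ⟨le_rfl, le_rfl⟩ x y)
  have h1 := hp.continuous
  have h2 := f.continuous
  exact (by fun_prop : Continuous fun x => p x * f (x + y, x - y)).aestronglyMeasurable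

theorem hasDerivAt_shiftedMoment {p : E → ℂ} (hp : QuadraticGrowth p) (f : 𝓢(E × E, ℂ)) (e : E)
    (s : ℝ) :
    HasDerivAt (fun r : ℝ => shiftedMoment μ p f (r • e))
      (shiftedMoment μ p (∂_{((e, -e) : E × E)} f) (s • e)) s := by
  set f' : 𝓢(E × E, ℂ) := ∂_{((e, -e) : E × E)} f with hf'
  obtain ⟨B, hB, hB'⟩ := (LocallyBoundedFamily.const f').weighted_bound μ 0
  have hderiv : ∀ x : E, ∀ r : ℝ, HasDerivAt (fun r : ℝ => p x * f (x + r • e, x - r • e))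
      (p x * f' (x + r • e, x - r • e)) r := by
    intro x r
    have hc : HasDerivAt (fun r : ℝ => (x + r • e, x - r • e)) (e, -e) r := by
      have h := (hasDerivAt_id r).smul_const e
      rw [one_smul] at h
      exact (h.const_add x).prodMk (h.const_sub x)
    have hf := (f.differentiableAt (x := (x + r • e, x - r • e))).hasFDerivAt.comp_hasDerivAt r hc
    rw [hf', SchwartzMap.lineDerivOp_apply_eq_fderiv]
    exact hf.const_mul (p x)
  have h := hasDerivAt_integral_of_dominated_loc_of_deriv_le (𝕜 := ℝ) (μ := μ) (bound := B)
    (x₀ := s) (s := Set.univ) (F := fun (r : ℝ) x => p x * f (x + r • e, x - r • e))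
    (F' := fun (r : ℝ) x => p x * f' (x + r • e, x - r • e))
    univ_mem (Eventually.of_forall fun r => (hp.integrable f (r • e)).aestronglyMeasurable)
    (hp.integrable f (s • e)) (hp.integrable f' (s • e)).aestronglyMeasurable
    (Eventually.of_forall fun x r _ => hB' p hp 0 ⟨le_rfl, le_rfl⟩ x _) hB
    (Eventually.of_forall fun x r _ => hderiv x r)
  exact h.2

theorem shiftedMoment_lineDerivOp_diag {p q : E → ℂ} (hp : QuadraticGrowth p)
    (hq : QuadraticGrowth q) (v : E) (hpq : ∀ x, HasLineDerivAt ℝ p (q x) x v)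
    (f : 𝓢(E × E, ℂ)) (y : E) :
    shiftedMoment μ p (∂_{((v, v) : E × E)} f) y = -shiftedMoment μ q f y := by
  refine integral_bilinear_hasLineDerivAt_right_eq_neg_left_of_integrable (μ := μ)
    (B := ContinuousLinearMap.mul ℝ ℂ) (f := p) (f' := q) (v := v)
    (g := fun x => f (x + y, x - y))
    (g' := fun x => (∂_{((v, v) : E × E)} f) (x + y, x - y))
    (hq.integrable f y) (hp.integrable _ y) (hp.integrable f y) (fun x _ => hpq x) fun x _ => ?_
  rw [SchwartzMap.lineDerivOp_apply_eq_fderiv]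
  have hc : HasDerivAt (fun r : ℝ => (x + r • v + y, x + r • v - y)) (v, v) 0 := by
    have h := (hasDerivAt_id (0 : ℝ)).smul_const v
    simp only [id, one_smul] at h
    exact ((h.const_add x).add_const y).prodMk ((h.const_add x).sub_const y)
  have hf := f.differentiableAt (x := (x + (0 : ℝ) • v + y, x + (0 : ℝ) • v - y))
    |>.hasFDerivAt.comp_hasDerivAt 0 hc
  simpa [HasLineDerivAt, Function.comp_def] using hf

theorem shiftedMoment_sum {ι : Type*} (s : Finset ι) {p : E → ℂ} (hp : QuadraticGrowth p)
    (f : ι → 𝓢(E × E, ℂ)) (y : E) :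
    shiftedMoment μ p (∑ j ∈ s, f j) y = ∑ j ∈ s, shiftedMoment μ p (f j) y := by
  simp only [shiftedMoment, sum_apply, Finset.mul_sum]
  exact integral_finsetSum _ fun j _ => hp.integrable (f j) y

/-- The evolution equation satisfied by a moment when the kernel solves an equation whose
right-hand side is a constant multiple of a Schwartz operator plus a bounded potential that is
constant on each antidiagonal shift of the diagonal. -/
theorem hasDerivWithinAt_shiftedMoment {p : E → ℂ} (hp : QuadraticGrowth p)
    {S : ℝ → 𝓢(E × E, ℂ)} (hS : LocallyBoundedFamily S)
    (L : 𝓢(E × E, ℂ) →L[ℝ] 𝓢(E × E, ℂ)) (a : ℂ) (W : E → ℂ)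
    (hSt : ∀ x y t, 0 ≤ t → HasDerivWithinAt (fun τ => S τ (x + y, x - y))
      (a * L (S t) (x + y, x - y) - W y * S t (x + y, x - y)) (Set.Ici 0) t)
    (y : E) {t : ℝ} (ht : 0 ≤ t) :
    HasDerivWithinAt (fun τ => shiftedMoment μ p (S τ) y)
      (a * shiftedMoment μ p (L (S t)) y - W y * shiftedMoment μ p (S t) y) (Set.Ici 0) t := by
  have h := hasDerivWithinAt_integral_of_locally_dominated (μ := μ)
    (u := fun τ x => p x * S τ (x + y, x - y))
    (u' := fun τ x => a * (p x * L (S τ) (x + y, x - y)) - W y * (p x * S τ (x + y, x - y)))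
    (fun τ => hp.integrable _ y) ?_ ?_ ht
  · rw [integral_sub ((hp.integrable _ y).const_mul _) ((hp.integrable _ y).const_mul _),
      integral_const_mul, integral_const_mul] at h
    exact h
  · intro T
    obtain ⟨B, hB, hB'⟩ := (hS.clm_comp L).weighted_bound μ T
    obtain ⟨D, hD, hD'⟩ := hS.weighted_bound μ T
    refine ⟨fun x => ‖a‖ * B x + ‖W y‖ * D x, (hB.const_mul _).add (hD.const_mul _),
      fun τ hτ x => (norm_sub_le _ _).trans ?_⟩
    rw [norm_mul a, norm_mul (W y)]
    exact add_le_add (mul_le_mul_of_nonneg_left (hB' p hp τ hτ x y) (norm_nonneg _))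
      (mul_le_mul_of_nonneg_left (hD' p hp τ hτ x y) (norm_nonneg _))
  · intro x τ hτ
    exact ((hSt x y τ hτ).const_mul (p x)).congr_deriv (by ring)

end Moments

open LineDeriv

theorem SchwartzMap.lineDerivOp_comm {F : Type*} [NormedAddCommGroup F] [NormedSpace ℝ F]
    (v w : F) (f : 𝓢(F, ℂ)) : ∂_{v} (∂_{w} f) = ∂_{w} (∂_{v} f) := by
  have key : ∀ a b : F, ∀ z, (∂_{a} (∂_{b} f) : 𝓢(F, ℂ)) z = fderiv ℝ (fderiv ℝ f) z a b := by
    intro a b z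
    rw [SchwartzMap.lineDerivOp_apply_eq_fderiv]
    have h1 : ((∂_{b} f : 𝓢(F, ℂ)) : F → ℂ) = fun z => fderiv ℝ f z b :=
      funext fun z => SchwartzMap.lineDerivOp_apply_eq_fderiv b f z
    have h2 : DifferentiableAt ℝ (fderiv ℝ f) z :=
      ((f.smooth 2).fderiv_right (m := 1) (by norm_num)).differentiable (by norm_num) z
    rw [h1, fderiv_clm_apply h2 (differentiableAt_const b)]
    simp
  ext z
  rw [key, key]
  exact ((f.smooth 2).contDiffAt.isSymmSndFDerivAt (by simp)).eq v w

theorem SchwartzMap.lineDerivOp_diag_antidiag {E : Type*} [NormedAddCommGroup E]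
    [NormedSpace ℝ E] (v : E) (f : 𝓢(E × E, ℂ)) :
    ∂_{((v, v) : E × E)} (∂_{((v, -v) : E × E)} f) =
      ∂_{((v, 0) : E × E)} (∂_{((v, 0) : E × E)} f)
        - ∂_{((0, v) : E × E)} (∂_{((0, v) : E × E)} f) := by
  have h1 : ((v, v) : E × E) = (v, 0) + (0, v) := by simp
  have h2 : ((v, -v) : E × E) = (v, 0) + -(0, v) := by simp
  rw [h1, h2]
  simp only [lineDerivOp_left_add, lineDerivOp_left_neg, lineDerivOp_add, lineDerivOp_neg]
  rw [SchwartzMap.lineDerivOp_comm (0, v) (v, 0)]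
  abel

/-- The operator `Δ_x - Δ_{x'}` on Schwartz kernels, in factorised form. -/
noncomputable def kineticOp (d : ℕ) :
    𝓢(EuclideanSpace ℝ (Fin d) × EuclideanSpace ℝ (Fin d), ℂ) →L[ℝ]
      𝓢(EuclideanSpace ℝ (Fin d) × EuclideanSpace ℝ (Fin d), ℂ) :=
  ∑ j : Fin d,
    (lineDerivOpCLM ℝ _ ((EuclideanSpace.single j 1, EuclideanSpace.single j 1) :
        EuclideanSpace ℝ (Fin d) × EuclideanSpace ℝ (Fin d))) ∘L
      (lineDerivOpCLM ℝ _ ((EuclideanSpace.single j 1, -EuclideanSpace.single j 1) :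
        EuclideanSpace ℝ (Fin d) × EuclideanSpace ℝ (Fin d)))

section Euclidean

variable {d : ℕ}

local notation "X" => EuclideanSpace ℝ (Fin d)

local notation "𝐞[" j "]" => (EuclideanSpace.single j (1 : ℝ) : X)

theorem kineticOp_apply (f : 𝓢(X × X, ℂ)) :
    kineticOp d f = ∑ j, ∂_{((𝐞[j], 𝐞[j]) : X × X)} (∂_{((𝐞[j], -𝐞[j]) : X × X)} f) := by
  simp [kineticOp]

theorem kineticOp_apply_apply (f : 𝓢(X × X, ℂ)) (x x' : X) :
    kineticOp d f (x, x') =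
      euclLaplacianC d (fun y => f (y, x')) x - euclLaplacianC d (fun y' => f (x, y')) x' := by
  have h1 : ∀ (h : 𝓢(X × X, ℂ)) (y y' v : X),
      fderiv ℝ (fun y => h (y, y')) y v = (∂_{((v, 0) : X × X)} h) (y, y') := by
    intro h y y' v
    have hc : HasFDerivAt (fun y : X => (y, y')) (ContinuousLinearMap.inl ℝ X X) y :=
      hasFDerivAt_prodMk_left y y'
    have := (h.differentiableAt (x := (y, y'))).hasFDerivAt.comp y hc
    rw [SchwartzMap.lineDerivOp_apply_eq_fderiv]
    exact (DFunLike.congr_fun this.fderiv v).trans (by simp)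
  have h2 : ∀ (h : 𝓢(X × X, ℂ)) (y y' v : X),
      fderiv ℝ (fun y' => h (y, y')) y' v = (∂_{((0, v) : X × X)} h) (y, y') := by
    intro h y y' v
    have hc : HasFDerivAt (fun y' : X => (y, y')) (ContinuousLinearMap.inr ℝ X X) y' :=
      hasFDerivAt_prodMk_right y y'
    have := (h.differentiableAt (x := (y, y'))).hasFDerivAt.comp y' hc
    rw [SchwartzMap.lineDerivOp_apply_eq_fderiv]
    exact (DFunLike.congr_fun this.fderiv v).trans (by simp)
  simp only [euclLaplacianC, h1, h2, kineticOp_apply, SchwartzMap.lineDerivOp_diag_antidiag,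
    sum_apply, sub_apply, Finset.sum_sub_distrib]

theorem norm_coord_le (x : X) (i : Fin d) : ‖((x i : ℝ) : ℂ)‖ ≤ ‖x‖ := by
  rw [Complex.norm_real]
  exact PiLp.norm_apply_le x i

theorem quadraticGrowth_coord (i : Fin d) : QuadraticGrowth fun x : X => ((x i : ℝ) : ℂ) where
  continuous := by fun_prop
  norm_le x := (norm_coord_le x i).trans (by nlinarith [norm_nonneg x])

theorem quadraticGrowth_two_mul_coord (i : Fin d) :
    QuadraticGrowth fun x : X => 2 * ((x i : ℝ) : ℂ) where
  continuous := by fun_prop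
  norm_le x := by
    rw [norm_mul, Complex.norm_two]
    nlinarith [norm_nonneg x, norm_coord_le x i]

theorem quadraticGrowth_norm_sq : QuadraticGrowth fun x : X => ((‖x‖ ^ 2 : ℝ) : ℂ) where
  continuous := by fun_prop
  norm_le x := by
    rw [Complex.norm_real, norm_pow, norm_norm]
    nlinarith [norm_nonneg x]

theorem hasLineDerivAt_coord (i j : Fin d) (x : X) :
    HasLineDerivAt ℝ (fun x : X => ((x i : ℝ) : ℂ)) (if i = j then 1 else 0) x 𝐞[j] := by
  have h : HasFDerivAt (fun x : X => ((x i : ℝ) : ℂ))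
      (Complex.ofRealCLM ∘L (EuclideanSpace.proj i : X →L[ℝ] ℝ)) x :=
    (Complex.ofRealCLM ∘L (EuclideanSpace.proj i : X →L[ℝ] ℝ)).hasFDerivAt
  have h' := h.hasLineDerivAt 𝐞[j]
  have hv : (Complex.ofRealCLM ∘L (EuclideanSpace.proj i : X →L[ℝ] ℝ)) 𝐞[j] =
      if i = j then 1 else 0 := by
    by_cases hij : i = j <;> simp [hij]
  rwa [hv] at h'

theorem hasLineDerivAt_norm_sq (j : Fin d) (x : X) :
    HasLineDerivAt ℝ (fun x : X => ((‖x‖ ^ 2 : ℝ) : ℂ)) (2 * ((x j : ℝ) : ℂ)) x 𝐞[j] := by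
  have h := Complex.ofRealCLM.hasFDerivAt.comp x (hasStrictFDerivAt_norm_sq x).hasFDerivAt
  have h' := h.hasLineDerivAt 𝐞[j]
  have hv : (Complex.ofRealCLM ∘L (2 • innerSL ℝ x)) 𝐞[j] = 2 * ((x j : ℝ) : ℂ) := by
    simp [EuclideanSpace.inner_single_right]
  rwa [hv] at h'

theorem quadraticGrowth_one : QuadraticGrowth fun _ : X => (1 : ℂ) :=
  quadraticGrowth_of_norm_le_one (by simp)

theorem quadraticGrowth_zero : QuadraticGrowth fun _ : X => (0 : ℂ) :=
  quadraticGrowth_of_norm_le_one (by simp)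

theorem shiftedMoment_kineticOp {p : X → ℂ} (hp : QuadraticGrowth p) {q : Fin d → X → ℂ}
    (hq : ∀ j, QuadraticGrowth (q j)) (hpq : ∀ j x, HasLineDerivAt ℝ p (q j x) x 𝐞[j])
    (f : 𝓢(X × X, ℂ)) (y : X) :
    shiftedMoment volume p (kineticOp d f) y =
      -∑ j, shiftedMoment volume (q j) (∂_{((𝐞[j], -𝐞[j]) : X × X)} f) y := by
  rw [kineticOp_apply, shiftedMoment_sum _ hp, ← Finset.sum_neg_distrib]
  exact Finset.sum_congr rfl fun j _ =>
    shiftedMoment_lineDerivOp_diag hp (hq j) 𝐞[j] (hpq j) _ y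

theorem shiftedMoment_one_kineticOp (f : 𝓢(X × X, ℂ)) (y : X) :
    shiftedMoment volume (fun _ => 1) (kineticOp d f) y = 0 := by
  rw [shiftedMoment_kineticOp quadraticGrowth_one (q := fun _ _ => 0)
    (fun _ => quadraticGrowth_zero)
    (fun j x => by simpa using (hasFDerivAt_const (𝕜 := ℝ) (1 : ℂ) x).hasLineDerivAt 𝐞[j])]
  simp [shiftedMoment]

theorem shiftedMoment_coord_kineticOp (i : Fin d) (f : 𝓢(X × X, ℂ)) (y : X) :
    shiftedMoment volume (fun x => ((x i : ℝ) : ℂ)) (kineticOp d f) y =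
      -shiftedMoment volume (fun _ => 1) (∂_{((𝐞[i], -𝐞[i]) : X × X)} f) y := by
  rw [shiftedMoment_kineticOp (quadraticGrowth_coord i) (q := fun j _ => if i = j then 1 else 0)
    (fun j => quadraticGrowth_of_norm_le_one (by split_ifs <;> simp))
    (fun j x => hasLineDerivAt_coord i j x)]
  congr 1
  rw [Finset.sum_eq_single i]
  · simp
  · intro j _ hj
    simp [shiftedMoment, hj.symm]
  · simp

theorem shiftedMoment_norm_sq_kineticOp (f : 𝓢(X × X, ℂ)) (y : X) :
    shiftedMoment volume (fun x => ((‖x‖ ^ 2 : ℝ) : ℂ)) (kineticOp d f) y =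
      -(2 * ∑ j, shiftedMoment volume (fun x => ((x j : ℝ) : ℂ))
        (∂_{((𝐞[j], -𝐞[j]) : X × X)} f) y) := by
  rw [shiftedMoment_kineticOp quadraticGrowth_norm_sq quadraticGrowth_two_mul_coord
    hasLineDerivAt_norm_sq, Finset.mul_sum]
  simp only [shiftedMoment, mul_assoc, integral_const_mul]

/-- A kernel family solving the Liouville equation in the coordinates `(x + y, x - y)`, with
kinetic constant `a` and potential `W y`. -/
structure SolvesLiouville (S : ℝ → 𝓢(X × X, ℂ)) (a : ℂ) (W : X → ℂ) : Prop where
  locallyBounded : LocallyBoundedFamily S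
  hasDerivWithinAt : ∀ x y t, 0 ≤ t → HasDerivWithinAt (fun τ => S τ (x + y, x - y))
    (a * kineticOp d (S t) (x + y, x - y) - W y * S t (x + y, x - y)) (Set.Ici 0) t

variable {S : ℝ → 𝓢(EuclideanSpace ℝ (Fin d) × EuclideanSpace ℝ (Fin d), ℂ)} {a : ℂ}
  {W : EuclideanSpace ℝ (Fin d) → ℂ}

theorem SolvesLiouville.shiftedMoment_one (h : SolvesLiouville S a W) (y : X) {t : ℝ}
    (ht : 0 ≤ t) :
    shiftedMoment volume (fun _ => 1) (S t) y =
      Complex.exp (-(W y * t)) * shiftedMoment volume (fun _ => 1) (S 0) y := by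
  refine eq_of_linear_ode (a := W y) (b := fun _ => 0)
    (u := fun t => shiftedMoment volume (fun _ => 1) (S t) y)
    (v := fun t : ℝ => Complex.exp (-(W y * t)) * shiftedMoment volume (fun _ => 1) (S 0) y)
    (fun s hs => ?_) (fun s _ => ?_) (by simp) ht
  · refine (hasDerivWithinAt_shiftedMoment quadraticGrowth_one h.locallyBounded (kineticOp d) a W
      h.hasDerivWithinAt y hs).congr_deriv ?_
    rw [shiftedMoment_one_kineticOp, mul_zero]
  · have he : HasDerivAt (fun τ : ℝ => Complex.exp (-(W y * τ)))
        (Complex.exp (-(W y * s)) * (-(W y * 1))) s :=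
      (((hasDerivAt_id s).ofReal_comp).const_mul (W y)).neg.cexp
    exact (he.mul_const _).hasDerivWithinAt.congr_deriv (by ring)

theorem SolvesLiouville.shiftedMoment_one_antidiag (h : SolvesLiouville S a W) (i : Fin d)
    {w' : ℂ} {s : ℝ} (hw : HasDerivAt (fun r : ℝ => W (r • 𝐞[i])) w' s) {t : ℝ} (ht : 0 ≤ t) :
    shiftedMoment volume (fun _ => 1) (∂_{((𝐞[i], -𝐞[i]) : X × X)} (S t)) (s • 𝐞[i]) =
      Complex.exp (-(W (s • 𝐞[i]) * t)) *
        (shiftedMoment volume (fun _ => 1) (∂_{((𝐞[i], -𝐞[i]) : X × X)} (S 0)) (s • 𝐞[i])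
          - t * w' * shiftedMoment volume (fun _ => 1) (S 0) (s • 𝐞[i])) := by
  have h1 := hasDerivAt_shiftedMoment (μ := volume) quadraticGrowth_one (S t) 𝐞[i] s
  have h2 := (hw.mul_const (t : ℂ)).neg.cexp.mul
    (hasDerivAt_shiftedMoment (μ := volume) quadraticGrowth_one (S 0) 𝐞[i] s)
  have h3 : (fun r : ℝ => shiftedMoment volume (fun _ => 1) (S t) (r • 𝐞[i])) = fun r : ℝ =>
      Complex.exp (-(W (r • 𝐞[i]) * t)) * shiftedMoment volume (fun _ => 1) (S 0) (r • 𝐞[i]) :=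
    funext fun r => h.shiftedMoment_one _ ht
  rw [h3] at h1
  rw [h1.unique h2, Pi.neg_apply]
  ring

theorem SolvesLiouville.shiftedMoment_coord (h : SolvesLiouville S a W) (i : Fin d)
    {w' : ℂ} {s : ℝ} (hw : HasDerivAt (fun r : ℝ => W (r • 𝐞[i])) w' s) {t : ℝ} (ht : 0 ≤ t) :
    shiftedMoment volume (fun x => ((x i : ℝ) : ℂ)) (S t) (s • 𝐞[i]) =
      Complex.exp (-(W (s • 𝐞[i]) * t)) *
        (shiftedMoment volume (fun x => ((x i : ℝ) : ℂ)) (S 0) (s • 𝐞[i])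
          - a * (t * shiftedMoment volume (fun _ => 1)
                (∂_{((𝐞[i], -𝐞[i]) : X × X)} (S 0)) (s • 𝐞[i])
              - t ^ 2 / 2 * w' * shiftedMoment volume (fun _ => 1) (S 0) (s • 𝐞[i]))) := by
  set ω := W (s • 𝐞[i]) with hω
  set h0 := shiftedMoment volume (fun x => ((x i : ℝ) : ℂ)) (S 0) (s • 𝐞[i]) with hh0
  set f1 := shiftedMoment volume (fun _ => 1) (∂_{((𝐞[i], -𝐞[i]) : X × X)} (S 0)) (s • 𝐞[i])
    with hf1
  set f0 := shiftedMoment volume (fun _ => 1) (S 0) (s • 𝐞[i]) with hf0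
  refine eq_of_linear_ode (a := ω)
    (b := fun t : ℝ => -a * (Complex.exp (-(ω * t)) * (f1 - t * w' * f0)))
    (u := fun t => shiftedMoment volume (fun x => ((x i : ℝ) : ℂ)) (S t) (s • 𝐞[i]))
    (v := fun t : ℝ => Complex.exp (-(ω * t)) *
      (h0 - a * (t * f1 - (t : ℂ) ^ 2 / 2 * w' * f0)))
    (fun r hr => ?_) (fun r _ => ?_) (by simp [hh0]) ht
  · refine (hasDerivWithinAt_shiftedMoment (quadraticGrowth_coord i) h.locallyBounded (kineticOp d)
      a W h.hasDerivWithinAt (s • 𝐞[i]) hr).congr_deriv ?_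
    rw [shiftedMoment_coord_kineticOp, h.shiftedMoment_one_antidiag i hw hr]
    ring
  · have hid : HasDerivAt (fun τ : ℝ => (τ : ℂ)) 1 r := (hasDerivAt_id r).ofReal_comp
    have he : HasDerivAt (fun τ : ℝ => Complex.exp (-(ω * τ)))
        (Complex.exp (-(ω * r)) * (-(ω * 1))) r := (hid.const_mul ω).neg.cexp
    have hp : HasDerivAt (fun τ : ℝ => h0 - a * (τ * f1 - (τ : ℂ) ^ 2 / 2 * w' * f0))
        (-(a * (f1 - r * w' * f0))) r := by
      refine ((((hid.mul_const f1).sub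
        ((((hid.pow 2).div_const 2).mul_const w').mul_const f0)).const_mul a).const_sub
          h0).congr_deriv ?_
      simp
    exact (he.mul hp).hasDerivWithinAt.congr_deriv (by ring)

theorem SolvesLiouville.shiftedMoment_coord_antidiag_zero (h : SolvesLiouville S a W) (i : Fin d)
    (hW0 : W 0 = 0) {w' : ℝ → ℂ} {w'' : ℂ}
    (hw : ∀ s : ℝ, HasDerivAt (fun r : ℝ => W (r • 𝐞[i])) (w' s) s) (hw0 : w' 0 = 0)
    (hw' : HasDerivAt w' w'' 0) {t : ℝ} (ht : 0 ≤ t) :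
    shiftedMoment volume (fun x => ((x i : ℝ) : ℂ)) (∂_{((𝐞[i], -𝐞[i]) : X × X)} (S t)) 0 =
      shiftedMoment volume (fun x => ((x i : ℝ) : ℂ)) (∂_{((𝐞[i], -𝐞[i]) : X × X)} (S 0)) 0
        - a * (t * shiftedMoment volume (fun _ => 1) (∂_{((𝐞[i], -𝐞[i]) : X × X)}
                (∂_{((𝐞[i], -𝐞[i]) : X × X)} (S 0))) 0
            - t ^ 2 / 2 * w'' * shiftedMoment volume (fun _ => 1) (S 0) 0) := by
  have h1 := hasDerivAt_shiftedMoment (μ := volume) (quadraticGrowth_coord i) (S t) 𝐞[i] 0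
  have h3 := fun s : ℝ => h.shiftedMoment_coord i (hw s) ht
  rw [funext h3] at h1
  have d1 := hasDerivAt_shiftedMoment (μ := volume) (quadraticGrowth_coord i) (S 0) 𝐞[i] 0
  have d2 := hasDerivAt_shiftedMoment (μ := volume) quadraticGrowth_one (S 0) 𝐞[i] 0
  have d3 := hasDerivAt_shiftedMoment (μ := volume) quadraticGrowth_one
    (∂_{((𝐞[i], -𝐞[i]) : X × X)} (S 0)) 𝐞[i] 0
  have h2 := ((hw 0).mul_const (t : ℂ)).neg.cexp.mul
    (d1.sub (((d3.const_mul (t : ℂ)).sub ((hw'.const_mul ((t : ℂ) ^ 2 / 2)).mul d2)).const_mul a))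
  have h4 := h1.unique h2
  simp only [Pi.neg_apply, zero_smul, hW0, hw0, zero_mul, mul_zero, neg_zero, Complex.exp_zero,
    one_mul, add_zero, zero_add] at h4
  exact h4

theorem SolvesLiouville.exists_shiftedMoment_norm_sq (h : SolvesLiouville S a W)
    (hW0 : W 0 = 0) {w' : Fin d → ℝ → ℂ} {w'' : Fin d → ℂ}
    (hw : ∀ i, ∀ s : ℝ, HasDerivAt (fun r : ℝ => W (r • 𝐞[i])) (w' i s) s)
    (hw0 : ∀ i, w' i 0 = 0) (hw' : ∀ i, HasDerivAt (w' i) (w'' i) 0) :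
    ∃ A B C : ℂ, ∀ t : ℝ, 0 ≤ t →
      shiftedMoment volume (fun x : X => ((‖x‖ ^ 2 : ℝ) : ℂ)) (S t) 0 =
        A + B * t + C * t ^ 2
          - a ^ 2 / 3 * (∑ i, w'' i) * shiftedMoment volume (fun _ => 1) (S 0) 0 * t ^ 3 := by
  set M := shiftedMoment volume (fun _ => 1) (S 0) 0 with hM
  set P := ∑ i, shiftedMoment volume (fun x => ((x i : ℝ) : ℂ))
    (∂_{((𝐞[i], -𝐞[i]) : X × X)} (S 0)) 0 with hP
  set Q := ∑ i, shiftedMoment volume (fun _ => 1) (∂_{((𝐞[i], -𝐞[i]) : X × X)}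
    (∂_{((𝐞[i], -𝐞[i]) : X × X)} (S 0))) 0 with hQ
  refine ⟨shiftedMoment volume (fun x : X => ((‖x‖ ^ 2 : ℝ) : ℂ)) (S 0) 0, -(2 * a * P),
    a ^ 2 * Q, fun t ht => ?_⟩
  refine eq_of_linear_ode (a := 0)
    (b := fun t : ℝ => -(2 * a * P) + 2 * (a ^ 2 * Q) * t - a ^ 2 * (∑ i, w'' i) * M * t ^ 2)
    (u := fun t => shiftedMoment volume (fun x : X => ((‖x‖ ^ 2 : ℝ) : ℂ)) (S t) 0)
    (v := fun t : ℝ => shiftedMoment volume (fun x : X => ((‖x‖ ^ 2 : ℝ) : ℂ)) (S 0) 0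
      + -(2 * a * P) * (t : ℂ) + a ^ 2 * Q * (t : ℂ) ^ 2
      - a ^ 2 / 3 * (∑ i, w'' i) * M * (t : ℂ) ^ 3)
    (fun r hr => ?_) (fun r _ => ?_) (by simp) ht
  · refine (hasDerivWithinAt_shiftedMoment quadraticGrowth_norm_sq h.locallyBounded (kineticOp d)
      a W h.hasDerivWithinAt 0 hr).congr_deriv ?_
    rw [shiftedMoment_norm_sq_kineticOp, hW0, Finset.sum_congr rfl fun i _ =>
      h.shiftedMoment_coord_antidiag_zero i hW0 (hw i) (hw0 i) (hw' i) hr]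
    rw [Finset.sum_sub_distrib, ← Finset.mul_sum, Finset.sum_sub_distrib, ← Finset.mul_sum,
      ← Finset.sum_mul, ← Finset.mul_sum, ← hP, ← hQ, ← hM]
    ring
  · have hid : HasDerivAt (fun τ : ℝ => (τ : ℂ)) 1 r := (hasDerivAt_id r).ofReal_comp
    refine ((((hid.const_mul (-(2 * a * P))).const_add _).add
      ((hid.pow 2).const_mul (a ^ 2 * Q))).sub
      ((hid.pow 3).const_mul (a ^ 2 / 3 * (∑ i, w'' i) * M))).hasDerivWithinAt.congr_deriv ?_
    simp
    ring

end Euclidean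

/-- Superballistic transport on `ℝ^d` for the white-noise model. If `R`
solves the averaged quantum stochastic Liouville equation
`∂_t R(x,x',t) = −(iℏ/(2m))(Δ_x − Δ_{x'})R − (V₀/ℏ)²(g(0) − g(x−x'))R` on `[0,∞)`,
is C¹ in `t`, Schwartz in `(x,x')` with seminorms locally bounded in `t`, and `g` is an
even C² correlation function with `∇g(0) = 0` and bounded derivatives up to order 2, then
`∫ ‖x‖² R(x,x,t) dx = −(1/3)(V₀/m)²(Δg)(0)(∫ R(x,x,0) dx) t³ + O(t²)` as `t → ∞`. -/
theorem continuum_superballistic_transport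
    (d : ℕ) (hd : 1 ≤ d) (ℏ m V₀ : ℝ) (hℏ : 0 < ℏ) (hm : 0 < m) (hV₀ : 0 < V₀)
    (g : EuclideanSpace ℝ (Fin d) → ℝ) (hg : ContDiff ℝ 2 g)
    (hgeven : ∀ x, g (-x) = g x) (hggrad : fderiv ℝ g 0 = 0)
    (hgbdd : ∀ n : ℕ, n ≤ 2 → ∃ C : ℝ, ∀ x, ‖iteratedFDeriv ℝ n g x‖ ≤ C)
    (R : EuclideanSpace ℝ (Fin d) → EuclideanSpace ℝ (Fin d) → ℝ → ℂ)
    -- `R(·,·,t)` is Schwartz class, with Schwartz seminorms locally bounded in `t`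
    (hSchwartz : ∃ S : ℝ → SchwartzMap
        (EuclideanSpace ℝ (Fin d) × EuclideanSpace ℝ (Fin d)) ℂ,
      (∀ (t : ℝ) (x x' : EuclideanSpace ℝ (Fin d)), S t (x, x') = R x x' t) ∧
      ∀ (kk nn : ℕ) (T : ℝ), ∃ C : ℝ, ∀ t ∈ Set.Icc (0 : ℝ) T,
        SchwartzMap.seminorm ℝ kk nn (S t) ≤ C)
    -- `R` is C¹ in `t` on `[0,∞)` and solves the averaged Liouville equation there
    (hPDE : ∀ (x x' : EuclideanSpace ℝ (Fin d)) (t : ℝ), 0 ≤ t →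
      HasDerivWithinAt (fun τ => R x x' τ)
        (-(Complex.I * (ℏ : ℂ) / (2 * (m : ℂ))) *
            (euclLaplacianC d (fun y => R y x' t) x
              - euclLaplacianC d (fun y' => R x y' t) x')
          - (((V₀ / ℏ) ^ 2 * (g 0 - g (x - x')) : ℝ) : ℂ) * R x x' t)
        (Set.Ici 0) t) :
    (fun t : ℝ =>
        (∫ x : EuclideanSpace ℝ (Fin d), ((‖x‖ ^ 2 : ℝ) : ℂ) * R x x t)
          - ((-(1 / 3) * (V₀ / m) ^ 2 * euclLaplacianR d g 0 : ℝ) : ℂ)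
              * (∫ x : EuclideanSpace ℝ (Fin d), R x x 0) * (t : ℂ) ^ 3)
      =O[atTop] fun t : ℝ => t ^ 2 := by
  obtain ⟨S, hSR, hSb⟩ := hSchwartz
  set a : ℂ := -(Complex.I * (ℏ : ℂ) / (2 * (m : ℂ))) with ha
  set c : ℝ := (V₀ / ℏ) ^ 2 with hc
  let e : Fin d → EuclideanSpace ℝ (Fin d) := fun i => EuclideanSpace.single i 1
  let W : EuclideanSpace ℝ (Fin d) → ℂ := fun y => ((c * (g 0 - g ((2 : ℝ) • y)) : ℝ) : ℂ)
  have hsol : SolvesLiouville S a W := by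
    refine ⟨hSb, fun x y t ht => ?_⟩
    have h := hPDE (x + y) (x - y) t ht
    have h2 : x + y - (x - y) = (2 : ℝ) • y := by rw [two_smul]; abel
    rw [h2] at h
    rw [kineticOp_apply_apply]
    simp only [hSR]
    exact h
  have hW0 : W 0 = 0 := by simp [W]
  have hline : ∀ i, ∀ s : ℝ, HasDerivAt (fun r : ℝ => (2 : ℝ) • r • e i) ((2 : ℝ) • e i) s := by
    intro i s
    have h := ((hasDerivAt_id s).smul_const (e i)).const_smul (2 : ℝ)
    rwa [one_smul] at h
  have hw : ∀ i, ∀ s : ℝ, HasDerivAt (fun r : ℝ => W (r • e i))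
      ((-(2 * c) * fderiv ℝ g ((2 : ℝ) • s • e i) (e i) : ℝ) : ℂ) s := by
    intro i s
    have hd := (hg.differentiable (by norm_num) ((2 : ℝ) • s • e i)).hasFDerivAt.comp_hasDerivAt s
      (hline i s)
    refine ((hd.const_sub (g 0)).const_mul c).ofReal_comp.congr_deriv ?_
    rw [map_smul, smul_eq_mul]
    push_cast
    ring
  have hw' : ∀ i, HasDerivAt
      (fun s : ℝ => ((-(2 * c) * fderiv ℝ g ((2 : ℝ) • s • e i) (e i) : ℝ) : ℂ))
      ((-(4 * c) * fderiv ℝ (fun y => fderiv ℝ g y (e i)) 0 (e i) : ℝ) : ℂ) 0 := by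
    intro i
    have hdiff : Differentiable ℝ fun y => fderiv ℝ g y (e i) :=
      ((hg.fderiv_right (m := 1) (by norm_num)).differentiable (by norm_num)).clm_apply
        (differentiable_const _)
    have hd := (hdiff ((2 : ℝ) • (0 : ℝ) • e i)).hasFDerivAt.comp_hasDerivAt 0 (hline i 0)
    refine (hd.const_mul (-(2 * c))).ofReal_comp.congr_deriv ?_
    rw [map_smul, smul_eq_mul, zero_smul, smul_zero]
    push_cast
    ring
  obtain ⟨A, B, C, hABC⟩ := hsol.exists_shiftedMoment_norm_sq hW0 hw
    (fun i => by simp [hggrad]) hw'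
  have hcoef : -(a ^ 2 / 3 * ∑ i,
      ((-(4 * c) * fderiv ℝ (fun y => fderiv ℝ g y (e i)) 0 (e i) : ℝ) : ℂ))
      = ((-(1 / 3) * (V₀ / m) ^ 2 * euclLaplacianR d g 0 : ℝ) : ℂ) := by
    rw [← Complex.ofReal_sum, ← Finset.mul_sum]
    change -(a ^ 2 / 3 * ((-(4 * c) * euclLaplacianR d g 0 : ℝ) : ℂ)) = _
    have hm' : (m : ℂ) ≠ 0 := Complex.ofReal_ne_zero.2 hm.ne'
    have hℏ' : (ℏ : ℂ) ≠ 0 := Complex.ofReal_ne_zero.2 hℏ.ne'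
    have ha2 : a ^ 2 = -((ℏ : ℂ) ^ 2 / (4 * (m : ℂ) ^ 2)) := by
      rw [ha, neg_sq, div_pow, mul_pow, Complex.I_sq]
      ring
    rw [ha2, hc]
    push_cast
    field_simp
  have hpoly : (fun t : ℝ => A + B * t + C * (t : ℂ) ^ 2) =O[atTop] fun t : ℝ => t ^ 2 := by
    refine IsBigO.of_bound (‖A‖ + ‖B‖ + ‖C‖) ?_
    filter_upwards [eventually_ge_atTop 1] with t ht
    have ht0 : 0 ≤ t := by linarith
    have h1 : t ≤ t ^ 2 := by nlinarith
    have h2 : 1 ≤ t ^ 2 := by nlinarith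
    rw [Real.norm_of_nonneg (sq_nonneg t)]
    calc ‖A + B * t + C * (t : ℂ) ^ 2‖ ≤ ‖A‖ + ‖B‖ * t + ‖C‖ * t ^ 2 := by
          refine (norm_add₃_le).trans_eq ?_
          simp [abs_of_nonneg ht0]
      _ ≤ ‖A‖ * t ^ 2 + ‖B‖ * t ^ 2 + ‖C‖ * t ^ 2 := by
          gcongr
          exact le_mul_of_one_le_right (norm_nonneg _) h2
      _ = (‖A‖ + ‖B‖ + ‖C‖) * t ^ 2 := by ring
  refine hpoly.congr' ?_ EventuallyEq.rfl
  filter_upwards [eventually_ge_atTop 0] with t ht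
  have h := hABC t ht
  simp only [shiftedMoment, add_zero, sub_zero, hSR, one_mul] at h
  rw [h, ← hcoef]
  ring
end

section
/- Let d ≥ 1 and ℏ, m, V₀ > 0. Let g : ℤ^d → ℝ be even (g(−Y) = g(Y)) with Γ_j := (V₀/ℏ)²(g(0) − g(ê_j)) > 0 and (V₀/ℏ)²(g(0) − g(2ê_j)) > 0 for each standard basis vector ê_j, j = 1,…,d. Suppose R : ℤ^d × ℤ^d × [0,∞) → ℂ is C¹ in t, with Σ_{x,x'} (1 + ‖x‖² + ‖x'‖²)|R(x,x',t)| finite and locally bounded in t (and the equation termwise differentiable), R(x,x',0) real-valued, and R solves ∂_t R(x,x',t) = −(iℏ/(2m))(Δ_x − Δ_{x'})R(x,x',t) − (V₀/ℏ)²(g(0) − g(x−x'))R(x,x',t), where Δ is the discrete nearest-neighbor Laplacian (Δf)(x) = Σ_{y : ‖x−y‖₁ = 1} f(y). Then the mean square displacement is diffusive: sup_{t ≥ 0} | Σ_{x ∈ ℤ^d} ‖x‖² R(x,x,t) − D t | < ∞, where D = (ℏ/m)² (Σ_{j=1}^d Γ_j^{−1}) (Σ_{x ∈ ℤ^d} R(x,x,0)).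 -/
open Filter

/-- Squared Euclidean norm of a lattice point `x ∈ ℤ^d`. -/
noncomputable def latticeNormSq (d : ℕ) (x : Fin d → ℤ) : ℝ :=
  ∑ j : Fin d, ((x j : ℝ)) ^ 2

/-- The discrete nearest-neighbor Laplacian
`(Δf)(x) = Σ_{y : ‖x−y‖₁ = 1} f(y) = Σ_j [f(x+ê_j) + f(x−ê_j)]` on `ℤ^d`. -/
noncomputable def latticeLaplacian (d : ℕ) (f : (Fin d → ℤ) → ℂ) (x : Fin d → ℤ) : ℂ :=
  ∑ j : Fin d, (f (x + Pi.single j 1) + f (x - Pi.single j 1))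

section LocallySummable

open Set MeasureTheory

/-- A family of functions, continuous on `[0, ∞)`, that is absolutely summable at every time
`t ≥ 0` with locally bounded absolute sums. -/
structure LocallySummable {ι : Type*} (f : ι → ℝ → ℂ) : Prop where
  cont : ∀ i, ContinuousOn (f i) (Ici 0)
  summable : ∀ t, 0 ≤ t → Summable fun i => ‖f i t‖
  bdd : ∀ T : ℝ, ∃ C : ℝ, ∀ t ∈ Icc (0 : ℝ) T, ∑' i, ‖f i t‖ ≤ C

namespace LocallySummable

variable {ι κ : Type*} {f h : ι → ℝ → ℂ}

theorem summable' (hf : LocallySummable f) {t : ℝ} (ht : 0 ≤ t) : Summable fun i => f i t :=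
  (hf.summable t ht).of_norm

theorem zero : LocallySummable fun (_ : ι) (_ : ℝ) => (0 : ℂ) where
  cont _ := continuousOn_const
  summable _ _ := by simp
  bdd _ := ⟨0, by simp⟩

theorem const_mul (hf : LocallySummable f) (c : ℂ) : LocallySummable fun i t => c * f i t where
  cont i := continuousOn_const.mul (hf.cont i)
  summable t ht := by simpa using (hf.summable t ht).mul_left ‖c‖
  bdd T := by
    obtain ⟨C, hC⟩ := hf.bdd T
    refine ⟨‖c‖ * C, fun t ht => ?_⟩
    simp only [norm_mul, tsum_mul_left]
    exact mul_le_mul_of_nonneg_left (hC t ht) (norm_nonneg c)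

theorem add (hf : LocallySummable f) (hh : LocallySummable h) :
    LocallySummable fun i t => f i t + h i t where
  cont i := (hf.cont i).add (hh.cont i)
  summable t ht := .of_nonneg_of_le (fun _ => norm_nonneg _) (fun _ => norm_add_le _ _)
    ((hf.summable t ht).add (hh.summable t ht))
  bdd T := by
    obtain ⟨C, hC⟩ := hf.bdd T
    obtain ⟨C', hC'⟩ := hh.bdd T
    refine ⟨C + C', fun t ht => ?_⟩
    have hs := (hf.summable t ht.1).add (hh.summable t ht.1)
    calc ∑' i, ‖f i t + h i t‖ ≤ ∑' i, (‖f i t‖ + ‖h i t‖) :=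
          Summable.tsum_le_tsum (fun _ => norm_add_le _ _)
            (.of_nonneg_of_le (fun _ => norm_nonneg _) (fun _ => norm_add_le _ _) hs) hs
      _ = ∑' i, ‖f i t‖ + ∑' i, ‖h i t‖ := (hf.summable t ht.1).tsum_add (hh.summable t ht.1)
      _ ≤ C + C' := add_le_add (hC t ht) (hC' t ht)

theorem sub (hf : LocallySummable f) (hh : LocallySummable h) :
    LocallySummable fun i t => f i t - h i t := by
  simpa [sub_eq_add_neg] using hf.add (hh.const_mul (-1))

theorem sum {F : κ → ι → ℝ → ℂ} (s : Finset κ) (hF : ∀ k, LocallySummable (F k)) :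
    LocallySummable fun i t => ∑ k ∈ s, F k i t := by
  classical
  induction s using Finset.induction_on with
  | empty => simpa using zero
  | insert k s hk ih => simpa [Finset.sum_insert hk] using (hF k).add ih

theorem comp_equiv (hf : LocallySummable f) (e : κ ≃ ι) :
    LocallySummable fun k t => f (e k) t where
  cont k := hf.cont (e k)
  summable t ht := (e.summable_iff (f := fun i => ‖f i t‖)).2 (hf.summable t ht)
  bdd T := by
    obtain ⟨C, hC⟩ := hf.bdd T
    exact ⟨C, fun t ht => (e.tsum_eq fun i => ‖f i t‖).trans_le (hC t ht)⟩

variable {f' : ι → ℝ → ℂ}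

theorem tsum_sub_eq_integral [Countable ι] (hf : LocallySummable f) (hf' : LocallySummable f')
    (hd : ∀ i t, 0 ≤ t → HasDerivWithinAt (f i) (f' i t) (Ici 0) t) {u t : ℝ} (hu : 0 ≤ u)
    (hut : u ≤ t) : ∑' i, f i t - ∑' i, f i u = ∫ s in u..t, ∑' i, f' i s := by
  have hsub : Icc u t ⊆ Ici 0 := fun s hs => hu.trans hs.1
  have hint : ∀ i, IntegrableOn (f' i) (Ioc u t) := fun i =>
    (((hf'.cont i).mono hsub).integrableOn_Icc).mono_set Ioc_subset_Icc_self
  have hFTC : ∀ i, ∫ s in Ioc u t, f' i s = f i t - f i u := fun i => by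
    rw [← intervalIntegral.integral_of_le hut]
    refine intervalIntegral.integral_eq_sub_of_hasDeriv_right_of_le hut
      ((hf.cont i).mono hsub) (fun s hs => ?_)
      ((intervalIntegrable_iff_integrableOn_Ioc_of_le hut).2 (hint i))
    have h0 : 0 ≤ s := hu.trans hs.1.le
    exact (hd i s h0).mono fun r hr => h0.trans (le_of_lt hr)
  obtain ⟨C, hC⟩ := hf'.bdd t
  have hsum : Summable fun i => ∫ s in Ioc u t, ‖f' i s‖ := by
    refine summable_of_sum_le (c := ∫ _ in Ioc u t, C)
      (fun i => integral_nonneg fun _ => norm_nonneg _) fun v => ?_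
    rw [← integral_finsetSum v fun i _ => (hint i).norm]
    refine setIntegral_mono_on (integrable_finsetSum v fun i _ => (hint i).norm)
      (by simp) measurableSet_Ioc fun s hs => ?_
    have h0 : 0 ≤ s := hu.trans hs.1.le
    exact ((hf'.summable s h0).sum_le_tsum v fun _ _ => norm_nonneg _).trans (hC s ⟨h0, hs.2⟩)
  have key := (hasSum_integral_of_summable_integral_norm hint hsum).tsum_eq
  simp only [hFTC] at key
  rw [intervalIntegral.integral_of_le hut, ← key,
    (hf.summable' (hu.trans hut)).tsum_sub (hf.summable' hu)]

theorem continuousOn_tsum [Countable ι] (hf : LocallySummable f) (hf' : LocallySummable f')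
    (hd : ∀ i t, 0 ≤ t → HasDerivWithinAt (f i) (f' i t) (Ici 0) t) :
    ContinuousOn (fun t => ∑' i, f i t) (Ici 0) := by
  have hlip : ∀ T C : ℝ, (∀ t ∈ Icc (0 : ℝ) T, ∑' i, ‖f' i t‖ ≤ C) → ∀ u t, 0 ≤ u → u ≤ t →
      t ≤ T → ‖∑' i, f i t - ∑' i, f i u‖ ≤ C * |t - u| := by
    intro T C hC u t hu hut htT
    rw [hf.tsum_sub_eq_integral hf' hd hu hut]
    refine intervalIntegral.norm_integral_le_of_norm_le_const fun s hs => ?_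
    rw [uIoc_of_le hut] at hs
    have h0 : 0 ≤ s := hu.trans hs.1.le
    exact (norm_tsum_le_tsum_norm (hf'.summable s h0)).trans (hC s ⟨h0, hs.2.trans htT⟩)
  intro t ht
  obtain ⟨C, hC⟩ := hf'.bdd (t + 1)
  rw [ContinuousWithinAt, tendsto_iff_norm_sub_tendsto_zero]
  have hlim : Tendsto (fun s : ℝ => C * |s - t|) (nhdsWithin t (Ici 0)) (nhds 0) := by
    have : Continuous fun s : ℝ => C * |s - t| := by fun_prop
    simpa using (this.tendsto t).mono_left nhdsWithin_le_nhds
  refine squeeze_zero' (Eventually.of_forall fun _ => norm_nonneg _) ?_ hlim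
  filter_upwards [self_mem_nhdsWithin,
    mem_nhdsWithin_of_mem_nhds (Iio_mem_nhds (lt_add_one t))] with s hs0 hs1
  rcases le_total t s with hts | hst
  · exact hlip _ C hC t s ht hts (le_of_lt hs1)
  · rw [norm_sub_rev, abs_sub_comm]
    exact hlip _ C hC s t hs0 hst (by linarith)

theorem hasDerivWithinAt_tsum [Countable ι] (hf : LocallySummable f) (hf' : LocallySummable f')
    (hd : ∀ i t, 0 ≤ t → HasDerivWithinAt (f i) (f' i t) (Ici 0) t)
    {G : ℝ → ℂ} (hG : ContinuousOn G (Ici 0)) (hfG : ∀ t, 0 ≤ t → ∑' i, f' i t = G t)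
    {t : ℝ} (ht : 0 ≤ t) : HasDerivWithinAt (fun t => ∑' i, f i t) (G t) (Ici 0) t := by
  have hcont : Continuous fun s => G (max 0 s) :=
    hG.comp_continuous (by fun_prop) fun s => le_max_left 0 s
  have hder := ((hcont.integral_hasStrictDerivAt 0 t).hasDerivAt.const_add
    (∑' i, f i 0)).hasDerivWithinAt (s := Ici 0)
  rw [max_eq_right ht] at hder
  have hS : ∀ s ∈ Ici (0 : ℝ),
      ∑' i, f i s = ∑' i, f i 0 + ∫ r in (0 : ℝ)..s, G (max 0 r) := fun s hs => by
    rw [← sub_eq_iff_eq_add', hf.tsum_sub_eq_integral hf' hd le_rfl hs]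
    refine intervalIntegral.integral_congr fun r hr => ?_
    rw [uIcc_of_le hs] at hr
    simp only [max_eq_right hr.1, hfG r hr.1]
  exact hder.congr hS (hS t ht)

end LocallySummable

/-- Solutions of a damped linear equation with bounded forcing are bounded. -/
theorem exists_norm_le_of_hasDerivWithinAt_damped {J F : ℝ → ℂ} {γ K : ℝ} (hγ : 0 < γ)
    (hJ : ∀ t, 0 ≤ t → HasDerivWithinAt J (-(γ : ℂ) * J t + F t) (Ici 0) t)
    (hF : ∀ t, 0 ≤ t → ‖F t‖ ≤ K) : ∃ C, ∀ t, 0 ≤ t → ‖J t‖ ≤ C := by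
  have hK : 0 ≤ K := (norm_nonneg _).trans (hF 0 le_rfl)
  refine ⟨‖J 0‖ + K / γ, fun t ht => ?_⟩
  have hexpR : ∀ s : ℝ, HasDerivAt (fun s : ℝ => Real.exp (γ * s)) (Real.exp (γ * s) * γ) s :=
    fun s => by simpa using ((hasDerivAt_id s).const_mul γ).exp
  have hmul : ∀ s, 0 ≤ s → HasDerivWithinAt (fun s => (Real.exp (γ * s) : ℂ) * J s)
      ((Real.exp (γ * s) : ℂ) * F s) (Ici 0) s := fun s hs => by
    refine ((hexpR s).ofReal_comp.hasDerivWithinAt.mul (hJ s hs)).congr_deriv ?_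
    push_cast
    ring
  have hB : ∀ s : ℝ, HasDerivAt (fun s => ‖J 0‖ + K / γ * Real.exp (γ * s))
      (K * Real.exp (γ * s)) s := fun s => by
    refine (((hexpR s).const_mul (K / γ)).const_add ‖J 0‖).congr_deriv ?_
    field_simp
  have key := image_norm_le_of_norm_deriv_right_le_deriv_boundary
    (f := fun s => (Real.exp (γ * s) : ℂ) * J s) (a := 0) (b := t)
    (fun s hs => ((hmul s hs.1).continuousWithinAt).mono fun r hr => hr.1)
    (fun s hs => (hmul s hs.1).mono fun r hr => hs.1.trans hr)
    (B := fun s => ‖J 0‖ + K / γ * Real.exp (γ * s)) (by simp; positivity) hB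
    (fun s hs => by
      rw [norm_mul, Complex.norm_real, Real.norm_of_nonneg (Real.exp_pos _).le, mul_comm]
      exact mul_le_mul_of_nonneg_right (hF s hs.1) (Real.exp_pos _).le)
    (right_mem_Icc.2 ht)
  rw [norm_mul, Complex.norm_real, Real.norm_of_nonneg (Real.exp_pos _).le] at key
  have h1 : 1 ≤ Real.exp (γ * t) := Real.one_le_exp (by positivity)
  have h2 : Real.exp (γ * t) * ‖J t‖ ≤ Real.exp (γ * t) * (‖J 0‖ + K / γ) := by
    nlinarith [norm_nonneg (J 0)]
  exact le_of_mul_le_mul_left h2 (Real.exp_pos _)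

theorem eq_initial_of_hasDerivWithinAt_zero {f : ℝ → ℂ}
    (hf : ∀ t, 0 ≤ t → HasDerivWithinAt f 0 (Ici 0) t) {t : ℝ} (ht : 0 ≤ t) : f t = f 0 :=
  constant_of_has_deriv_right_zero
    (fun s hs => (hf s hs.1).continuousWithinAt.mono fun _ hr => hr.1)
    (fun s hs => (hf s hs.1).mono fun _ hr => hs.1.trans hr) t (right_mem_Icc.2 ht)

end LocallySummable

section DiagonalMoments

open Set

variable {d : ℕ}

/-- At most quadratic growth of a weight on the lattice. -/
def QuadraticGrowth_s1 (w : (Fin d → ℤ) → ℂ) : Prop :=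
  ∃ c : ℝ, 0 ≤ c ∧ ∀ x, ‖w x‖ ≤ c * (1 + latticeNormSq d x)

theorem latticeNormSq_nonneg (x : Fin d → ℤ) : 0 ≤ latticeNormSq d x :=
  Finset.sum_nonneg fun _ _ => sq_nonneg _

theorem latticeNormSq_add_le (x z : Fin d → ℤ) :
    latticeNormSq d (x + z) ≤ 2 * latticeNormSq d x + 2 * latticeNormSq d z := by
  simp only [latticeNormSq, Finset.mul_sum, ← Finset.sum_add_distrib]
  refine Finset.sum_le_sum fun j _ => ?_
  push_cast [Pi.add_apply]
  nlinarith [sq_nonneg ((x j : ℝ) - z j)]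

theorem latticeNormSq_add_single (x : Fin d → ℤ) (k : Fin d) (ε : ℤ)
    (hε : ε ^ 2 = 1) :
    latticeNormSq d (x + Pi.single k ε) = latticeNormSq d x + 2 * ε * x k + 1 := by
  have hε' : (ε : ℝ) ^ 2 = 1 := by exact_mod_cast hε
  have h : ∀ j, (((x + Pi.single k ε : Fin d → ℤ) j : ℤ) : ℝ) ^ 2
      = (x j : ℝ) ^ 2 + if j = k then 2 * ε * (x k : ℝ) + 1 else 0 := fun j => by
    by_cases hjk : j = k
    · subst hjk
      simp only [Pi.add_apply, Pi.single_eq_same, if_true]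
      push_cast
      linear_combination hε'
    · simp [hjk]
  simp only [latticeNormSq, h, Finset.sum_add_distrib, Finset.sum_ite_eq', Finset.mem_univ,
    if_true]
  ring

theorem QuadraticGrowth_s1.comp_add {w : (Fin d → ℤ) → ℂ} (hw : QuadraticGrowth_s1 w)
    (z : Fin d → ℤ) : QuadraticGrowth_s1 fun x => w (x + z) := by
  obtain ⟨c, hc, hwc⟩ := hw
  have hz := latticeNormSq_nonneg z
  refine ⟨c * (2 + 2 * latticeNormSq d z), by positivity, fun x => (hwc _).trans ?_⟩
  rw [mul_assoc]
  refine mul_le_mul_of_nonneg_left ?_ hc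
  nlinarith [latticeNormSq_add_le x z, latticeNormSq_nonneg x]

theorem QuadraticGrowth_s1.comp_sub {w : (Fin d → ℤ) → ℂ} (hw : QuadraticGrowth_s1 w) (z : Fin d → ℤ) :
    QuadraticGrowth_s1 fun x => w (x - z) := by
  simpa [sub_eq_add_neg] using hw.comp_add (-z)

theorem QuadraticGrowth_s1.const_mul {w : (Fin d → ℤ) → ℂ} (hw : QuadraticGrowth_s1 w) (c : ℂ) :
    QuadraticGrowth_s1 fun x => c * w x := by
  obtain ⟨b, hb, hwb⟩ := hw
  refine ⟨‖c‖ * b, by positivity, fun x => ?_⟩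
  rw [norm_mul, mul_assoc]
  exact mul_le_mul_of_nonneg_left (hwb x) (norm_nonneg c)

theorem QuadraticGrowth_s1.add {w : (Fin d → ℤ) → ℂ} {v : (Fin d → ℤ) → ℂ} (hw : QuadraticGrowth_s1 w)
    (hv : QuadraticGrowth_s1 v) : QuadraticGrowth_s1 fun x => w x + v x := by
  obtain ⟨b, hb, hwb⟩ := hw
  obtain ⟨b', hb', hvb⟩ := hv
  refine ⟨b + b', by positivity, fun x => (norm_add_le _ _).trans ?_⟩
  rw [add_mul]
  exact add_le_add (hwb x) (hvb x)

theorem quadraticGrowth_one_s1 : QuadraticGrowth_s1 fun _ : Fin d → ℤ => (1 : ℂ) :=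
  ⟨1, zero_le_one, fun x => by simpa using latticeNormSq_nonneg x⟩

theorem quadraticGrowth_coord_s1 (j : Fin d) :
    QuadraticGrowth_s1 fun x : Fin d → ℤ => ((x j : ℤ) : ℂ) := by
  refine ⟨1, zero_le_one, fun x => ?_⟩
  have h : (x j : ℝ) ^ 2 ≤ latticeNormSq d x :=
    Finset.single_le_sum (f := fun j => (x j : ℝ) ^ 2) (fun _ _ => sq_nonneg _)
      (Finset.mem_univ j)
  rw [Complex.norm_intCast, one_mul]
  nlinarith [sq_nonneg (|(x j : ℝ)| - 1), sq_abs (x j : ℝ)]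

theorem quadraticGrowth_latticeNormSq :
    QuadraticGrowth_s1 fun x : Fin d → ℤ => ((latticeNormSq d x : ℝ) : ℂ) := by
  refine ⟨1, zero_le_one, fun x => ?_⟩
  rw [Complex.norm_real, Real.norm_of_nonneg (latticeNormSq_nonneg x)]
  linarith

/-- The weighted sum of `R` along the diagonal with offset `Y`. -/
noncomputable def diagonalMoment (R : (Fin d → ℤ) → (Fin d → ℤ) → ℝ → ℂ) (Y : Fin d → ℤ)
    (w : (Fin d → ℤ) → ℂ) (t : ℝ) : ℂ :=
  ∑' x, w x * R (x + Y) x t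

theorem diagonalMoment_const_mul (R : (Fin d → ℤ) → (Fin d → ℤ) → ℝ → ℂ)
    (w : (Fin d → ℤ) → ℂ) (Y : Fin d → ℤ) (c : ℂ) (t : ℝ) :
    diagonalMoment R Y (fun x => c * w x) t = c * diagonalMoment R Y w t := by
  simp only [diagonalMoment, mul_assoc, tsum_mul_left]

/-- The current in direction `j` that drives the second moment. -/
noncomputable def diagonalCurrent (R : (Fin d → ℤ) → (Fin d → ℤ) → ℝ → ℂ) (j : Fin d)
    (t : ℝ) : ℂ :=
  2 * diagonalMoment R (Pi.single j 1) (fun x => ((x j : ℤ) : ℂ)) t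
    - 2 * diagonalMoment R (-Pi.single j 1) (fun x => ((x j : ℤ) : ℂ)) t
    + diagonalMoment R (Pi.single j 1) (fun _ => 1) t
    + diagonalMoment R (-Pi.single j 1) (fun _ => 1) t

/-- The mass on the two diagonals at offsets `± 2 ê_j`. -/
noncomputable def pairMoment (R : (Fin d → ℤ) → (Fin d → ℤ) → ℝ → ℂ) (j : Fin d)
    (t : ℝ) : ℂ :=
  diagonalMoment R (Pi.single j 2) (fun _ => 1) t
    + diagonalMoment R (-Pi.single j 2) (fun _ => 1) t

/-- Solutions on `[0, ∞)`, with locally bounded second moments, of the Liouville equation with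
hopping constant `a` and damping rate `κ`. -/
structure IsLiouvilleSolution (a : ℂ) (κ : (Fin d → ℤ) → ℝ)
    (R : (Fin d → ℤ) → (Fin d → ℤ) → ℝ → ℂ) : Prop where
  summable : ∀ t : ℝ, 0 ≤ t → Summable (fun p : (Fin d → ℤ) × (Fin d → ℤ) =>
    (1 + latticeNormSq d p.1 + latticeNormSq d p.2) * ‖R p.1 p.2 t‖)
  bdd : ∀ T : ℝ, ∃ C : ℝ, ∀ t ∈ Icc (0 : ℝ) T,
    (∑' p : (Fin d → ℤ) × (Fin d → ℤ),
      (1 + latticeNormSq d p.1 + latticeNormSq d p.2) * ‖R p.1 p.2 t‖) ≤ C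
  deriv : ∀ (x x' : Fin d → ℤ) (t : ℝ), 0 ≤ t →
    HasDerivWithinAt (fun τ => R x x' τ)
      (-a * (latticeLaplacian d (fun y => R y x' t) x
          - latticeLaplacian d (fun y' => R x y' t) x') - (κ (x - x') : ℂ) * R x x' t)
      (Ici 0) t

namespace IsLiouvilleSolution

variable {a : ℂ} {κ : (Fin d → ℤ) → ℝ} {R : (Fin d → ℤ) → (Fin d → ℤ) → ℝ → ℂ}
  {w : (Fin d → ℤ) → ℂ}

theorem locallySummable (hR : IsLiouvilleSolution a κ R) (Y : Fin d → ℤ)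
    (hw : QuadraticGrowth_s1 w) : LocallySummable fun x t => w x * R (x + Y) x t := by
  obtain ⟨c, hc, hwc⟩ := hw
  let W : ℝ → (Fin d → ℤ) × (Fin d → ℤ) → ℝ := fun t p =>
    (1 + latticeNormSq d p.1 + latticeNormSq d p.2) * ‖R p.1 p.2 t‖
  have hW0 : ∀ t p, 0 ≤ W t p := fun t p => by
    have h1 := latticeNormSq_nonneg p.1
    have h2 := latticeNormSq_nonneg p.2
    positivity
  have hinj : Function.Injective fun x : Fin d → ℤ => (x + Y, x) :=
    fun x y h => congrArg Prod.snd h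
  have hle : ∀ t x, ‖w x * R (x + Y) x t‖ ≤ c * W t (x + Y, x) := fun t x => by
    rw [norm_mul, ← mul_assoc]
    refine mul_le_mul_of_nonneg_right ((hwc x).trans (mul_le_mul_of_nonneg_left ?_ hc))
      (norm_nonneg _)
    dsimp only
    linarith [latticeNormSq_nonneg (x + Y)]
  have hs : ∀ t, 0 ≤ t → Summable fun x => W t (x + Y, x) := fun t ht =>
    (hR.summable t ht).comp_injective hinj
  have hs' : ∀ t, 0 ≤ t → Summable fun x => ‖w x * R (x + Y) x t‖ := fun t ht =>
    .of_nonneg_of_le (fun _ => norm_nonneg _) (hle t) ((hs t ht).mul_left c)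
  refine ⟨fun x t ht => continuousWithinAt_const.mul
    (hR.deriv (x + Y) x t ht).continuousWithinAt, hs', fun T => ?_⟩
  obtain ⟨C, hC⟩ := hR.bdd T
  refine ⟨c * C, fun t ht => ?_⟩
  calc ∑' x, ‖w x * R (x + Y) x t‖ ≤ ∑' x, c * W t (x + Y, x) :=
        (hs' t ht.1).tsum_le_tsum (hle t) ((hs t ht.1).mul_left c)
    _ = c * ∑' x, W t (x + Y, x) := tsum_mul_left
    _ ≤ c * ∑' p, W t p := mul_le_mul_of_nonneg_left
        (tsum_comp_le_tsum_of_inj (hR.summable t ht.1) (hW0 t) hinj) hc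
    _ ≤ c * C := mul_le_mul_of_nonneg_left (hC t ht) hc

/-- The hopping contribution in direction `k` to the derivative of `w x * R (x + Y) x`. -/
def hoppingTerm (R : (Fin d → ℤ) → (Fin d → ℤ) → ℝ → ℂ) (Y : Fin d → ℤ)
    (w : (Fin d → ℤ) → ℂ) (k : Fin d) (x : Fin d → ℤ) (t : ℝ) : ℂ :=
  w x * R (x + (Y + Pi.single k 1)) x t + w x * R (x + (Y - Pi.single k 1)) x t
    - w x * R (x + Y) (x + Pi.single k 1) t - w x * R (x + Y) (x - Pi.single k 1) t

theorem comp_addRight_term (Y z : Fin d → ℤ) (t : ℝ) :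
    (fun x => w x * R (x + Y) (x + z) t) =
      fun x => (fun y => w (y - z) * R (y + (Y - z)) y t) (Equiv.addRight z x) := by
  funext x
  simp only [Equiv.coe_addRight, add_sub_cancel_right]
  rw [show x + z + (Y - z) = x + Y by abel]

theorem locallySummable_shift (hR : IsLiouvilleSolution a κ R) (Y z : Fin d → ℤ)
    (hw : QuadraticGrowth_s1 w) : LocallySummable fun x t => w x * R (x + Y) (x + z) t := by
  have h := (hR.locallySummable (Y - z) (hw.comp_sub z)).comp_equiv (Equiv.addRight z)
  have hxt : ∀ x t, w x * R (x + Y) (x + z) t = _ := fun x t =>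
    congrFun (comp_addRight_term (w := w) (R := R) Y z t) x
  simpa only [hxt] using h

theorem tsum_shift (Y z : Fin d → ℤ) (t : ℝ) :
    ∑' x, w x * R (x + Y) (x + z) t = diagonalMoment R (Y - z) (fun x => w (x - z)) t := by
  rw [comp_addRight_term]
  exact (Equiv.addRight z).tsum_eq fun y => w (y - z) * R (y + (Y - z)) y t

theorem locallySummable_hoppingTerm (hR : IsLiouvilleSolution a κ R) (Y : Fin d → ℤ)
    (hw : QuadraticGrowth_s1 w) (k : Fin d) : LocallySummable (hoppingTerm R Y w k) := by
  have h := hR.locallySummable_shift Y (-Pi.single k 1) hw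
  simp only [← sub_eq_add_neg] at h
  exact (((hR.locallySummable _ hw).add (hR.locallySummable _ hw)).sub
    (hR.locallySummable_shift Y _ hw)).sub h

theorem tsum_hoppingTerm (hR : IsLiouvilleSolution a κ R) (Y : Fin d → ℤ)
    (hw : QuadraticGrowth_s1 w) (k : Fin d) {t : ℝ} (ht : 0 ≤ t) :
    ∑' x, hoppingTerm R Y w k x t =
      diagonalMoment R (Y + Pi.single k 1) w t + diagonalMoment R (Y - Pi.single k 1) w t
        - diagonalMoment R (Y - Pi.single k 1) (fun x => w (x - Pi.single k 1)) t
        - diagonalMoment R (Y + Pi.single k 1) (fun x => w (x + Pi.single k 1)) t := by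
  have h1 := hR.locallySummable (Y + Pi.single k 1) hw
  have h2 := hR.locallySummable (Y - Pi.single k 1) hw
  have h3 := hR.locallySummable_shift Y (Pi.single k 1) hw
  have h4 := hR.locallySummable_shift Y (-Pi.single k 1) hw
  have e4 := tsum_shift (w := w) (R := R) Y (-Pi.single k 1) t
  simp only [← sub_eq_add_neg, sub_neg_eq_add] at h4 e4
  simp only [hoppingTerm]
  rw [(((h1.add h2).sub h3).summable' ht).tsum_sub (h4.summable' ht),
    ((h1.add h2).summable' ht).tsum_sub (h3.summable' ht),
    (h1.summable' ht).tsum_add (h2.summable' ht), tsum_shift, e4]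
  rfl

theorem locallySummable_deriv (hR : IsLiouvilleSolution a κ R) (Y : Fin d → ℤ)
    (hw : QuadraticGrowth_s1 w) : LocallySummable fun x t =>
      -a * ∑ k, hoppingTerm R Y w k x t - (κ Y : ℂ) * (w x * R (x + Y) x t) :=
  ((LocallySummable.sum Finset.univ (hR.locallySummable_hoppingTerm Y hw)).const_mul (-a)).sub
    ((hR.locallySummable Y hw).const_mul (κ Y))

theorem hasDerivWithinAt_term (hR : IsLiouvilleSolution a κ R) (Y x : Fin d → ℤ) (t : ℝ)
    (ht : 0 ≤ t) : HasDerivWithinAt (fun t => w x * R (x + Y) x t)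
      (-a * ∑ k, hoppingTerm R Y w k x t - (κ Y : ℂ) * (w x * R (x + Y) x t)) (Ici 0) t := by
  refine ((hR.deriv (x + Y) x t ht).const_mul (w x)).congr_deriv ?_
  have hx : ∑ k, hoppingTerm R Y w k x t = w x * (latticeLaplacian d (fun y => R y x t) (x + Y)
      - latticeLaplacian d (fun y' => R (x + Y) y' t) x) := by
    rw [latticeLaplacian, latticeLaplacian, ← Finset.sum_sub_distrib, Finset.mul_sum]
    refine Finset.sum_congr rfl fun k _ => ?_
    rw [hoppingTerm, ← add_assoc, ← add_sub_assoc]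
    ring
  rw [hx, add_sub_cancel_left]
  ring

theorem continuousOn_diagonalMoment (hR : IsLiouvilleSolution a κ R) (Y : Fin d → ℤ)
    (hw : QuadraticGrowth_s1 w) : ContinuousOn (diagonalMoment R Y w) (Ici 0) :=
  (hR.locallySummable Y hw).continuousOn_tsum (hR.locallySummable_deriv Y hw)
    (hR.hasDerivWithinAt_term Y)

theorem hasDerivWithinAt_diagonalMoment (hR : IsLiouvilleSolution a κ R) (Y : Fin d → ℤ)
    (hw : QuadraticGrowth_s1 w) {t : ℝ} (ht : 0 ≤ t) :
    HasDerivWithinAt (diagonalMoment R Y w)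
      (-a * ∑ k, (diagonalMoment R (Y + Pi.single k 1) w t
          + diagonalMoment R (Y - Pi.single k 1) w t
          - diagonalMoment R (Y - Pi.single k 1) (fun x => w (x - Pi.single k 1)) t
          - diagonalMoment R (Y + Pi.single k 1) (fun x => w (x + Pi.single k 1)) t)
        - (κ Y : ℂ) * diagonalMoment R Y w t) (Ici 0) t := by
  let H : Fin d → ℝ → ℂ := fun k t =>
    diagonalMoment R (Y + Pi.single k 1) w t + diagonalMoment R (Y - Pi.single k 1) w t
      - diagonalMoment R (Y - Pi.single k 1) (fun x => w (x - Pi.single k 1)) t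
      - diagonalMoment R (Y + Pi.single k 1) (fun x => w (x + Pi.single k 1)) t
  have hH : ∀ k, ContinuousOn (H k) (Ici 0) := fun k =>
    (((hR.continuousOn_diagonalMoment _ hw).add (hR.continuousOn_diagonalMoment _ hw)).sub
      (hR.continuousOn_diagonalMoment _ (hw.comp_sub _))).sub
        (hR.continuousOn_diagonalMoment _ (hw.comp_add _))
  have hG : ContinuousOn (fun t => -a * ∑ k, H k t - (κ Y : ℂ) * diagonalMoment R Y w t)
      (Ici 0) :=
    (continuousOn_const.mul (continuousOn_finsetSum _ fun k _ => hH k)).sub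
      (continuousOn_const.mul (hR.continuousOn_diagonalMoment Y hw))
  have hsum : ∀ s, 0 ≤ s →
      ∑' x, (-a * ∑ k, hoppingTerm R Y w k x s - (κ Y : ℂ) * (w x * R (x + Y) x s))
        = -a * ∑ k, H k s - (κ Y : ℂ) * diagonalMoment R Y w s := fun s hs => by
    have hF := fun k => hR.locallySummable_hoppingTerm Y hw k
    rw [((LocallySummable.sum Finset.univ hF).const_mul (-a)).summable' hs |>.tsum_sub
      (((hR.locallySummable Y hw).const_mul (κ Y)).summable' hs), tsum_mul_left, tsum_mul_left,
      Summable.tsum_finsetSum fun k _ => (hF k).summable' hs,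
      Finset.sum_congr rfl fun k _ => hR.tsum_hoppingTerm Y hw k hs]
    rfl
  exact (hR.locallySummable Y hw).hasDerivWithinAt_tsum (hR.locallySummable_deriv Y hw)
    (hR.hasDerivWithinAt_term Y) hG hsum ht

theorem diagonalMoment_add (hR : IsLiouvilleSolution a κ R) (Y : Fin d → ℤ)
    {v : (Fin d → ℤ) → ℂ} (hw : QuadraticGrowth_s1 w) (hv : QuadraticGrowth_s1 v) {t : ℝ}
    (ht : 0 ≤ t) :
    diagonalMoment R Y (fun x => w x + v x) t
      = diagonalMoment R Y w t + diagonalMoment R Y v t := by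
  simp only [diagonalMoment, add_mul]
  exact ((hR.locallySummable Y hw).summable' ht).tsum_add
    ((hR.locallySummable Y hv).summable' ht)

theorem hasDerivWithinAt_moment_one (hR : IsLiouvilleSolution a κ R) (Y : Fin d → ℤ) {t : ℝ}
    (ht : 0 ≤ t) : HasDerivWithinAt (diagonalMoment R Y fun _ => 1)
      (-(κ Y : ℂ) * diagonalMoment R Y (fun _ => 1) t) (Ici 0) t := by
  refine (hR.hasDerivWithinAt_diagonalMoment Y quadraticGrowth_one_s1 ht).congr_deriv ?_
  rw [Finset.sum_eq_zero fun k _ => by ring]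
  ring

theorem hasDerivWithinAt_moment_coord (hR : IsLiouvilleSolution a κ R) (Y : Fin d → ℤ)
    (j : Fin d) {t : ℝ} (ht : 0 ≤ t) :
    HasDerivWithinAt (diagonalMoment R Y fun x => ((x j : ℤ) : ℂ))
      (-(κ Y : ℂ) * diagonalMoment R Y (fun x => ((x j : ℤ) : ℂ)) t
        + a * (diagonalMoment R (Y + Pi.single j 1) (fun _ => 1) t
          - diagonalMoment R (Y - Pi.single j 1) (fun _ => 1) t)) (Ici 0) t := by
  refine (hR.hasDerivWithinAt_diagonalMoment Y (quadraticGrowth_coord_s1 j) ht).congr_deriv ?_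
  have hshift : ∀ (Z : Fin d → ℤ) (c : ℂ),
      diagonalMoment R Z (fun x => ((x j : ℤ) : ℂ) + c * 1) t
        = diagonalMoment R Z (fun x => ((x j : ℤ) : ℂ)) t
          + c * diagonalMoment R Z (fun _ => 1) t := fun Z c => by
    rw [hR.diagonalMoment_add Z (quadraticGrowth_coord_s1 j) (quadraticGrowth_one_s1.const_mul c) ht,
      diagonalMoment_const_mul]
  have hp : ∀ k, (fun x : Fin d → ℤ => (((x + Pi.single k 1 : Fin d → ℤ) j : ℤ) : ℂ))
      = fun x => ((x j : ℤ) : ℂ) + (if j = k then 1 else 0) * 1 := fun k => by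
    funext x
    simp [Pi.single_apply]
  have hm : ∀ k, (fun x : Fin d → ℤ => (((x - Pi.single k 1 : Fin d → ℤ) j : ℤ) : ℂ))
      = fun x => ((x j : ℤ) : ℂ) + (-if j = k then 1 else 0) * 1 := fun k => by
    funext x
    simp [Pi.single_apply, sub_eq_add_neg]
  simp only [hp, hm, hshift]
  rw [Finset.sum_eq_single j (fun k _ hk => by simp [hk.symm]) (by simp)]
  simp only [if_true]
  ring

theorem hasDerivWithinAt_moment_latticeNormSq (hR : IsLiouvilleSolution a κ R) (hκ : κ 0 = 0)
    {t : ℝ} (ht : 0 ≤ t) :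
    HasDerivWithinAt (diagonalMoment R 0 fun x => ((latticeNormSq d x : ℝ) : ℂ))
      (a * ∑ j, diagonalCurrent R j t) (Ici 0) t := by
  refine (hR.hasDerivWithinAt_diagonalMoment 0 quadraticGrowth_latticeNormSq ht).congr_deriv ?_
  have hshift : ∀ (Z : Fin d → ℤ) (k : Fin d) (ε : ℤ), ε ^ 2 = 1 →
      diagonalMoment R Z (fun x => ((latticeNormSq d (x + Pi.single k ε) : ℝ) : ℂ)) t
        = diagonalMoment R Z (fun x => ((latticeNormSq d x : ℝ) : ℂ)) t
          + (2 * ε * diagonalMoment R Z (fun x => ((x k : ℤ) : ℂ)) t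
            + diagonalMoment R Z (fun _ => 1) t) := fun Z k ε hε => by
    have hcoord := (quadraticGrowth_coord_s1 k).const_mul (2 * (ε : ℂ))
    rw [← diagonalMoment_const_mul, ← hR.diagonalMoment_add Z hcoord quadraticGrowth_one_s1 ht,
      ← hR.diagonalMoment_add Z quadraticGrowth_latticeNormSq
        (hcoord.add quadraticGrowth_one_s1) ht]
    congr 1
    funext x
    rw [latticeNormSq_add_single x k ε hε]
    push_cast
    ring
  have hneg : ∀ (x : Fin d → ℤ) k, x - Pi.single k 1 = x + Pi.single k (-1) := fun x k => by
    rw [Pi.single_neg, sub_eq_add_neg]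
  have hterm : ∀ k : Fin d, diagonalMoment R (0 + Pi.single k 1)
        (fun x => ((latticeNormSq d x : ℝ) : ℂ)) t
      + diagonalMoment R (0 - Pi.single k 1) (fun x => ((latticeNormSq d x : ℝ) : ℂ)) t
      - diagonalMoment R (0 - Pi.single k 1)
          (fun x => ((latticeNormSq d (x - Pi.single k 1) : ℝ) : ℂ)) t
      - diagonalMoment R (0 + Pi.single k 1)
          (fun x => ((latticeNormSq d (x + Pi.single k 1) : ℝ) : ℂ)) t
      = -diagonalCurrent R k t := fun k => by
    have hm := hshift (0 - Pi.single k 1) k (-1) (by norm_num)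
    simp only [← hneg] at hm
    rw [hm, hshift _ k 1 (by norm_num), diagonalCurrent, zero_add, zero_sub]
    push_cast
    ring
  simp only [hterm, hκ, Finset.sum_neg_distrib]
  push_cast
  ring

theorem hasDerivWithinAt_diagonalCurrent (hR : IsLiouvilleSolution a κ R)
    (hκ : ∀ Y, κ (-Y) = κ Y) (j : Fin d) {t : ℝ} (ht : 0 ≤ t) :
    HasDerivWithinAt (diagonalCurrent R j)
      (-(κ (Pi.single j 1) : ℂ) * diagonalCurrent R j t
        + 2 * a * (pairMoment R j t - 2 * diagonalMoment R 0 (fun _ => 1) t)) (Ici 0) t := by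
  refine (((((hR.hasDerivWithinAt_moment_coord (Pi.single j 1) j ht).const_mul 2).sub
    ((hR.hasDerivWithinAt_moment_coord (-Pi.single j 1) j ht).const_mul 2)).add
    (hR.hasDerivWithinAt_moment_one (Pi.single j 1) ht)).add
    (hR.hasDerivWithinAt_moment_one (-Pi.single j 1) ht)).congr_deriv ?_
  have h2 : (Pi.single j 1 + Pi.single j 1 : Fin d → ℤ) = Pi.single j 2 := by
    rw [← Pi.single_add]
    norm_num
  have h2' : (-Pi.single j 1 - Pi.single j 1 : Fin d → ℤ) = -Pi.single j 2 := by
    rw [← h2]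
    abel
  rw [h2, h2', sub_self, neg_add_cancel, hκ, diagonalCurrent, pairMoment]
  ring

theorem hasDerivWithinAt_pairMoment (hR : IsLiouvilleSolution a κ R)
    (hκ : ∀ Y, κ (-Y) = κ Y) (j : Fin d) {t : ℝ} (ht : 0 ≤ t) :
    HasDerivWithinAt (pairMoment R j) (-(κ (Pi.single j 2) : ℂ) * pairMoment R j t)
      (Ici 0) t := by
  refine ((hR.hasDerivWithinAt_moment_one (Pi.single j 2) ht).add
    (hR.hasDerivWithinAt_moment_one (-Pi.single j 2) ht)).congr_deriv ?_
  rw [hκ, pairMoment]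
  ring

theorem moment_one_zero_eq (hR : IsLiouvilleSolution a κ R) (hκ : κ 0 = 0) {t : ℝ}
    (ht : 0 ≤ t) : diagonalMoment R 0 (fun _ => 1) t = diagonalMoment R 0 (fun _ => 1) 0 :=
  eq_initial_of_hasDerivWithinAt_zero (fun s hs =>
    (hR.hasDerivWithinAt_moment_one 0 hs).congr_deriv (by simp [hκ])) ht

theorem exists_norm_pairMoment_le (hR : IsLiouvilleSolution a κ R) (hκ : ∀ Y, κ (-Y) = κ Y)
    (j : Fin d) (hpos : 0 < κ (Pi.single j 2)) : ∃ C, ∀ t, 0 ≤ t → ‖pairMoment R j t‖ ≤ C :=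
  exists_norm_le_of_hasDerivWithinAt_damped (F := 0) (K := 0) hpos
    (fun t ht => by simpa using hR.hasDerivWithinAt_pairMoment hκ j ht) (by simp)

theorem exists_norm_diagonalCurrent_le (hR : IsLiouvilleSolution a κ R) (hκ0 : κ 0 = 0)
    (hκ : ∀ Y, κ (-Y) = κ Y) (j : Fin d) (hpos : 0 < κ (Pi.single j 1))
    (hpos2 : 0 < κ (Pi.single j 2)) : ∃ C, ∀ t, 0 ≤ t → ‖diagonalCurrent R j t‖ ≤ C := by
  obtain ⟨C, hC⟩ := hR.exists_norm_pairMoment_le hκ j hpos2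
  refine exists_norm_le_of_hasDerivWithinAt_damped
    (K := ‖2 * a‖ * (C + ‖2 * diagonalMoment R 0 (fun _ => 1) 0‖)) hpos
    (fun t ht => hR.hasDerivWithinAt_diagonalCurrent hκ j ht) fun t ht => ?_
  rw [norm_mul, hR.moment_one_zero_eq hκ0 ht]
  exact mul_le_mul_of_nonneg_left ((norm_sub_le _ _).trans (by linarith [hC t ht]))
    (norm_nonneg _)

theorem exists_norm_secondMoment_sub_le (hR : IsLiouvilleSolution a κ R) (hκ0 : κ 0 = 0)
    (hκ : ∀ Y, κ (-Y) = κ Y) (hpos : ∀ j, 0 < κ (Pi.single j 1))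
    (hpos2 : ∀ j, 0 < κ (Pi.single j 2)) :
    ∃ C, ∀ t, 0 ≤ t → ‖diagonalMoment R 0 (fun x => ((latticeNormSq d x : ℝ) : ℂ)) t
      - -4 * a ^ 2 * (∑ j, (κ (Pi.single j 1) : ℂ)⁻¹) * diagonalMoment R 0 (fun _ => 1) 0 * t‖
        ≤ C := by
  choose CJ hCJ using fun j =>
    hR.exists_norm_diagonalCurrent_le hκ0 hκ j (hpos j) (hpos2 j)
  choose CN hCN using fun j => hR.exists_norm_pairMoment_le hκ j (hpos2 j)
  set P := diagonalMoment R 0 fun x => ((latticeNormSq d x : ℝ) : ℂ)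
  set M := diagonalMoment R 0 (fun _ => 1) 0
  let c : Fin d → ℂ := fun j => a * (κ (Pi.single j 1) : ℂ)⁻¹
  let b : Fin d → ℂ := fun j => 2 * a * (κ (Pi.single j 2) : ℂ)⁻¹
  let L : ℝ → ℂ := fun t => P t - -4 * a ^ 2 * (∑ j, (κ (Pi.single j 1) : ℂ)⁻¹) * M * t
  let Q : ℝ → ℂ := fun t => ∑ j, c j * (diagonalCurrent R j t + b j * pairMoment R j t)
  have hconst : ∀ t, 0 ≤ t → L t + Q t = L 0 + Q 0 := fun t ht => by
    refine eq_initial_of_hasDerivWithinAt_zero (f := fun t => L t + Q t) (fun s hs => ?_) ht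
    have hid : HasDerivWithinAt (fun s : ℝ => (s : ℂ)) 1 (Ici 0) s :=
      (hasDerivAt_id s).ofReal_comp.hasDerivWithinAt
    have hQ : HasDerivWithinAt Q _ (Ici 0) s := HasDerivWithinAt.fun_sum fun j _ =>
      ((hR.hasDerivWithinAt_diagonalCurrent hκ j hs).add
        ((hR.hasDerivWithinAt_pairMoment hκ j hs).const_mul (b j))).const_mul (c j)
    refine (((hR.hasDerivWithinAt_moment_latticeNormSq hκ0 hs).sub
      (hid.const_mul (-4 * a ^ 2 * (∑ j, (κ (Pi.single j 1) : ℂ)⁻¹) * M))).add hQ).congr_deriv ?_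
    rw [hR.moment_one_zero_eq hκ0 hs, Finset.mul_sum, Finset.mul_sum, Finset.sum_mul,
      Finset.sum_mul, ← Finset.sum_sub_distrib, ← Finset.sum_add_distrib]
    refine Finset.sum_eq_zero fun j _ => ?_
    have h1 : (κ (Pi.single j 1) : ℂ) ≠ 0 := by exact_mod_cast (hpos j).ne'
    have h2 : (κ (Pi.single j 2) : ℂ) ≠ 0 := by exact_mod_cast (hpos2 j).ne'
    simp only [c, b]
    field_simp
    ring
  refine ⟨‖L 0 + Q 0‖ + ∑ j, ‖c j‖ * (CJ j + ‖b j‖ * CN j), fun t ht => ?_⟩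
  have hQ : ‖Q t‖ ≤ ∑ j, ‖c j‖ * (CJ j + ‖b j‖ * CN j) := by
    refine norm_sum_le_of_le _ fun j _ => ?_
    rw [norm_mul]
    refine mul_le_mul_of_nonneg_left ((norm_add_le _ _).trans (add_le_add (hCJ j t ht) ?_))
      (norm_nonneg _)
    rw [norm_mul]
    exact mul_le_mul_of_nonneg_left (hCN j t ht) (norm_nonneg _)
  calc ‖L t‖ = ‖(L 0 + Q 0) - Q t‖ := by rw [← hconst t ht, add_sub_cancel_right]
    _ ≤ ‖L 0 + Q 0‖ + ‖Q t‖ := norm_sub_le _ _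
    _ ≤ _ := add_le_add_right hQ _

end IsLiouvilleSolution

end DiagonalMoments

/-- Diffusive transport on `ℤ^d` for the white-noise model. If `R` solves
the averaged quantum stochastic Liouville equation
`∂_t R(x,x',t) = −(iℏ/(2m))(Δ_x − Δ_{x'})R − (V₀/ℏ)²(g(0) − g(x−x'))R` on `[0,∞)`,
with `Σ_{x,x'} (1 + ‖x‖² + ‖x'‖²)|R(x,x',t)|` finite and locally bounded in `t`,
real initial data, `g` even with `Γ_j = (V₀/ℏ)²(g(0) − g(ê_j)) > 0` and
`(V₀/ℏ)²(g(0) − g(2ê_j)) > 0`, then the mean square displacement is diffusive: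
`sup_{t ≥ 0} |Σ_x ‖x‖² R(x,x,t) − D t| < ∞` with
`D = (ℏ/m)² (Σ_j Γ_j⁻¹)(Σ_x R(x,x,0))`. -/
theorem lattice_diffusive_transport
    (d : ℕ) (hd : 1 ≤ d) (ℏ m V₀ : ℝ) (hℏ : 0 < ℏ) (hm : 0 < m) (hV₀ : 0 < V₀)
    (g : (Fin d → ℤ) → ℝ) (hgeven : ∀ Y, g (-Y) = g Y)
    (hΓpos : ∀ j : Fin d, 0 < (V₀ / ℏ) ^ 2 * (g 0 - g (Pi.single j 1)))
    (hΓ2pos : ∀ j : Fin d, 0 < (V₀ / ℏ) ^ 2 * (g 0 - g (Pi.single j 2)))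
    (R : (Fin d → ℤ) → (Fin d → ℤ) → ℝ → ℂ)
    -- summability of `(1 + ‖x‖² + ‖x'‖²)|R(x,x',t)|`, locally bounded in `t`
    (hsum : ∀ t : ℝ, 0 ≤ t → Summable (fun p : (Fin d → ℤ) × (Fin d → ℤ) =>
      (1 + latticeNormSq d p.1 + latticeNormSq d p.2) * ‖R p.1 p.2 t‖))
    (hsumbdd : ∀ T : ℝ, ∃ C : ℝ, ∀ t ∈ Set.Icc (0 : ℝ) T,
      (∑' p : (Fin d → ℤ) × (Fin d → ℤ),
        (1 + latticeNormSq d p.1 + latticeNormSq d p.2) * ‖R p.1 p.2 t‖) ≤ C)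
    -- the initial data is real-valued
    (hreal : ∀ x x' : Fin d → ℤ, (R x x' 0).im = 0)
    -- `R` is C¹ in `t` on `[0,∞)` and solves the averaged Liouville equation there
    (hPDE : ∀ (x x' : Fin d → ℤ) (t : ℝ), 0 ≤ t →
      HasDerivWithinAt (fun τ => R x x' τ)
        (-(Complex.I * (ℏ : ℂ) / (2 * (m : ℂ))) *
            (latticeLaplacian d (fun y => R y x' t) x
              - latticeLaplacian d (fun y' => R x y' t) x')
          - (((V₀ / ℏ) ^ 2 * (g 0 - g (x - x')) : ℝ) : ℂ) * R x x' t)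
        (Set.Ici 0) t) :
    ∃ C : ℝ, ∀ t : ℝ, 0 ≤ t →
      ‖(∑' x : Fin d → ℤ, ((latticeNormSq d x : ℝ) : ℂ) * R x x t)
          - (((ℏ / m) ^ 2 *
                ∑ j : Fin d, ((V₀ / ℏ) ^ 2 * (g 0 - g (Pi.single j 1)))⁻¹ : ℝ) : ℂ)
              * (∑' x : Fin d → ℤ, R x x 0) * (t : ℂ)‖ ≤ C := by
  have hR : IsLiouvilleSolution (Complex.I * (ℏ : ℂ) / (2 * (m : ℂ)))
      (fun Y => (V₀ / ℏ) ^ 2 * (g 0 - g Y)) R := ⟨hsum, hsumbdd, hPDE⟩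
  obtain ⟨C, hC⟩ := hR.exists_norm_secondMoment_sub_le (by simp) (by simp [hgeven]) hΓpos hΓ2pos
  refine ⟨C, fun t ht => ?_⟩
  have ha : -4 * (Complex.I * (ℏ : ℂ) / (2 * (m : ℂ))) ^ 2 = ((ℏ : ℂ) / m) ^ 2 := by
    rw [div_pow, div_pow, mul_pow, mul_pow, Complex.I_sq]
    have hm' : (m : ℂ) ≠ 0 := by exact_mod_cast hm.ne'
    field_simp
    ring
  have h := hC t ht
  rw [ha] at h
  simp only [diagonalMoment, add_zero, one_mul] at h
  push_cast at h ⊢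
  exact h
end
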